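/- arXiv:1809.10938 — 2 statements merged into one kernel-verified Lean document; each statement's English description precedes it below -/
import Mathlib

section
/- For every η > 0 there exist δ > 0 and a positive integer k with the following property: for all positive integers m, n and every η-closed subset 𝒜 of M_{m,n}(F_2), there exists a nonempty set 𝒞 ⊆ M_{m,n}(F_2) that is an intersection of at most k basic sets and satisfies |𝒜 ∩ 𝒞| ≥ δ|𝒞|. -/
open Finset

/-- A basic set in `M_{m,n}(F_2)`: matrices `A` with `A x = y` for some fixed `x ≠ 0`, `y`,
or `Aᵀ x = y` for some fixed `x ≠ 0`, `y`. -/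
def IsBasic (m n : ℕ) (S : Finset (Matrix (Fin m) (Fin n) (ZMod 2))) : Prop :=
  (∃ x : Fin n → ZMod 2, x ≠ 0 ∧ ∃ y : Fin m → ZMod 2,
    S = Finset.univ.filter (fun A => A.mulVec x = y)) ∨
  (∃ x : Fin m → ZMod 2, x ≠ 0 ∧ ∃ y : Fin n → ZMod 2,
    S = Finset.univ.filter (fun A => A.transpose.mulVec x = y))

/-- The number of pairs `(A, R)` with `A ∈ 𝒜`, `R = u ⊗ v` a rank-one matrix
(`u ≠ 0`, `v ≠ 0`) and `A + R ∈ 𝒜`.  (A rank-one matrix over `F_2` determines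
`u` and `v` uniquely, so this counts pairs `(A, R)`.) -/
def closedPairs (m n : ℕ) (A : Finset (Matrix (Fin m) (Fin n) (ZMod 2))) : ℕ :=
  ((A ×ˢ (Finset.univ.filter
      (fun p : (Fin m → ZMod 2) × (Fin n → ZMod 2) => p.1 ≠ 0 ∧ p.2 ≠ 0))).filter
    (fun q => q.1 + Matrix.vecMulVec q.2.1 q.2.2 ∈ A)).card


namespace KMS
open Matrix

abbrev MM (m n : ℕ) := Matrix (Fin m) (Fin n) (ZMod 2)

noncomputable def sgn (x : ZMod 2) : ℝ := if x = 0 then 1 else -1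

lemma zmod2_cases (x : ZMod 2) : x = 0 ∨ x = 1 := by
  revert x; decide

lemma sgn_zero : sgn 0 = 1 := by simp [sgn]
lemma sgn_one : sgn 1 = -1 := by simp [sgn]

lemma sgn_add (x y : ZMod 2) : sgn (x + y) = sgn x * sgn y := by
  have h : (1 : ZMod 2) + 1 = 0 := by decide
  rcases zmod2_cases x with rfl | rfl <;> rcases zmod2_cases y with rfl | rfl <;>
    simp [sgn_zero, sgn_one, h]

lemma sgn_mul_self (x : ZMod 2) : sgn x * sgn x = 1 := by
  rcases zmod2_cases x with rfl | rfl <;> simp [sgn_zero, sgn_one]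

variable {m n : ℕ}

lemma add_self (X : MM m n) : X + X = 0 := by
  ext i j
  have : ∀ x : ZMod 2, x + x = 0 := by decide
  simp [this]

lemma add_add_self (X Y : MM m n) : X + (X + Y) = Y := by
  rw [← add_assoc, add_self, zero_add]

def ip (X A : MM m n) : ZMod 2 := (Xᵀ * A).trace

lemma ip_comm (X A : MM m n) : ip X A = ip A X := by
  unfold ip
  rw [← trace_transpose, transpose_mul, transpose_transpose]

lemma ip_add_right (X A B : MM m n) : ip X (A + B) = ip X A + ip X B := by
  simp [ip, Matrix.mul_add]

lemma ip_add_left (X Y A : MM m n) : ip (X + Y) A = ip X A + ip Y A := by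
  simp [ip, Matrix.add_mul]

lemma ip_mul_left (P : MM m m) (X A : MM m n) : ip (P * X) A = ip X (Pᵀ * A) := by
  simp [ip, Matrix.mul_assoc]

lemma ip_transpose (X A : MM m n) : ip Xᵀ Aᵀ = ip X A := by
  unfold ip
  rw [← trace_transpose, transpose_mul, trace_mul_comm]
  simp

lemma ip_vec (X : MM m n) (u : Fin m → ZMod 2) (v : Fin n → ZMod 2) :
    ip X (vecMulVec u v) = u ⬝ᵥ (X *ᵥ v) := by
  unfold ip
  rw [mul_vecMulVec, trace_vecMulVec, dotProduct_mulVec, ← mulVec_transpose]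

noncomputable def chi (X A : MM m n) : ℝ := sgn (ip X A)

lemma chi_comm (X A : MM m n) : chi X A = chi A X := by simp [chi, ip_comm]
lemma chi_add_right (X A B : MM m n) : chi X (A + B) = chi X A * chi X B := by
  simp [chi, ip_add_right, sgn_add]
lemma chi_add_left (X Y A : MM m n) : chi (X + Y) A = chi X A * chi Y A := by
  simp [chi, ip_add_left, sgn_add]
lemma chi_mul_self (X A : MM m n) : chi X A * chi X A = 1 := sgn_mul_self _

lemma sum_shift {G : Type*} [AddGroup G] [Fintype G] (b : G) (F : G → ℝ) :
    ∑ a, F (a + b) = ∑ a, F a :=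
  Fintype.sum_equiv (Equiv.addRight b) _ _ (fun _ => rfl)

lemma sum_chi (X : MM m n) :
    ∑ A, chi X A = if X = 0 then (Fintype.card (MM m n) : ℝ) else 0 := by
  split_ifs with h
  · subst h
    simp [chi, ip, sgn_zero]
  · obtain ⟨i, j, hij⟩ : ∃ i j, X i j ≠ 0 := by
      by_contra hc
      push Not at hc
      exact h (by ext i j; simp [hc])
    have h1 : X i j = 1 := (zmod2_cases _).resolve_left hij
    have key := sum_shift (vecMulVec (Pi.single i 1) (Pi.single j 1)) (chi X)
    have : chi X (vecMulVec (Pi.single i 1) (Pi.single j 1)) = -1 := by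
      rw [chi, ip_vec]
      simp [h1, sgn_one]
    simp only [chi_add_right, this] at key
    rw [← Finset.sum_mul] at key
    linarith

noncomputable def NN (m n : ℕ) : ℝ := (Fintype.card (MM m n) : ℝ)

lemma NN_pos : 0 < NN m n := by
  unfold NN; exact_mod_cast Fintype.card_pos

noncomputable def GG (g : MM m n → ℝ) (A : MM m n) : ℝ := ∑ X, g X * chi X A

lemma chi_orth (X Y : MM m n) :
    ∑ A, chi X A * chi Y A = if X = Y then NN m n else 0 := by
  simp only [← chi_add_left]
  rw [sum_chi]
  have : X + Y = 0 ↔ X = Y := by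
    constructor
    · intro h
      have := add_add_self X Y
      rw [h, add_zero] at this
      exact this
    · rintro rfl; exact add_self _
  simp [this, NN]

lemma sum_GG_sq (g : MM m n → ℝ) : ∑ A, (GG g A) ^ 2 = NN m n * ∑ X, g X ^ 2 := by
  have : ∀ A, (GG g A) ^ 2 = ∑ X, ∑ Y, (g X * g Y) * (chi X A * chi Y A) := by
    intro A
    rw [sq, GG, Finset.sum_mul_sum]
    refine Finset.sum_congr rfl fun X _ => Finset.sum_congr rfl fun Y _ => by ring
  simp only [this]
  rw [Finset.sum_comm, Finset.mul_sum]
  refine Finset.sum_congr rfl fun X _ => ?_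
  rw [Finset.sum_comm]
  simp only [← Finset.mul_sum, chi_orth]
  simp
  ring

lemma rank_add_le (X Y : MM m n) : (X + Y).rank ≤ X.rank + Y.rank := by
  unfold Matrix.rank
  rw [mulVecLin_add]
  refine (Submodule.finrank_mono (LinearMap.range_add_le _ _)).trans ?_
  exact Submodule.finrank_add_le_finrank_add_finrank _ _

lemma rank_eq_zero' (X : MM m n) (h : X.rank = 0) : X = 0 := by
  unfold Matrix.rank at h
  rw [Submodule.finrank_eq_zero, LinearMap.range_eq_bot] at h
  ext i j
  have := congrFun (LinearMap.congr_fun h (Pi.single j 1)) i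
  simpa using this

/-- pseudorandomness -/
def PR (m n k : ℕ) (δ : ℝ) (f : MM m n → ℝ) : Prop :=
  ∀ (P : MM m m) (Q : MM n n) (B : MM m n), m + n ≤ P.rank + Q.rank + k →
    ∑ A : MM m n, f (P * A * Q + B) ≤ δ * NN m n

lemma PR_sum {k : ℕ} {δ : ℝ} {f : MM m n → ℝ} (h : PR m n k δ f) : ∑ A, f A ≤ δ * NN m n := by
  have := h 1 1 0 (by simp [Matrix.rank_one])
  simpa using this

lemma sum_transpose (F : MM m n → ℝ) : ∑ A : MM n m, F Aᵀ = ∑ A, F A :=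
  Fintype.sum_equiv (Matrix.transposeAddEquiv (Fin n) (Fin m) (ZMod 2)).toEquiv _ _ (fun _ => rfl)

lemma NN_transpose : NN n m = NN m n := by
  have := sum_transpose (m := m) (n := n) (fun _ => (1:ℝ))
  simpa [NN] using this

lemma PR_transpose {k : ℕ} {δ : ℝ} {f : MM m n → ℝ} (h : PR m n k δ f) :
    PR n m k δ (fun A => f Aᵀ) := by
  intro P Q B hk
  have := h Qᵀ Pᵀ Bᵀ (by rw [rank_transpose, rank_transpose]; omega)
  rw [← sum_transpose] at this
  rw [NN_transpose]
  refine le_trans (le_of_eq ?_) this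
  refine Finset.sum_congr rfl fun A _ => ?_
  simp [Matrix.mul_assoc]

lemma PR_zoom {k : ℕ} {δ : ℝ} {f : MM m n → ℝ} (h : PR m n (k+1) δ f)
    (a φ : Fin m → ZMod 2) (B' : MM m n) :
    PR m n k δ (fun A => f ((1 + vecMulVec φ a) * A + B')) := by
  intro P Q B hk
  have hr : P.rank ≤ ((1 + vecMulVec φ a) * P).rank + 1 := by
    have e : P = (1 + vecMulVec φ a) * P + vecMulVec φ a * P := by
      rw [Matrix.add_mul, add_assoc, add_self]; simp
    calc P.rank = ((1 + vecMulVec φ a) * P + vecMulVec φ a * P).rank := by rw [← e]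
      _ ≤ ((1 + vecMulVec φ a) * P).rank + (vecMulVec φ a * P).rank := rank_add_le _ _
      _ ≤ _ := by
        gcongr
        exact (rank_mul_le_left _ _).trans (rank_vecMulVec_le _ _)
  have := h ((1 + vecMulVec φ a) * P) Q ((1 + vecMulVec φ a) * B + B') (by omega)
  refine le_trans (le_of_eq ?_) this
  refine Finset.sum_congr rfl fun A _ => ?_
  simp only [Matrix.mul_add, Matrix.mul_assoc, add_assoc]

lemma avg_zoom (a φ : Fin m → ZMod 2) (F : MM m n → ℝ) :
    ∑ y : Fin n → ZMod 2, ∑ A : MM m n, F ((1 + vecMulVec φ a) * A + vecMulVec φ y)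
      = (Fintype.card (Fin n → ZMod 2) : ℝ) * ∑ A, F A := by
  have h1 : ∀ A : MM m n, ∀ y, (1 + vecMulVec φ a) * A + vecMulVec φ y
      = A + vecMulVec φ (y + a ᵥ* A) := by
    intro A y
    rw [Matrix.add_mul, Matrix.one_mul, vecMulVec_mul, vecMulVec_add, add_assoc,
      add_comm (vecMulVec φ y)]
  simp only [h1]
  rw [Finset.sum_comm]
  have h2 : ∀ A : MM m n, ∑ y, F (A + vecMulVec φ (y + a ᵥ* A)) = ∑ y, F (A + vecMulVec φ y) :=
    fun A => sum_shift (a ᵥ* A) (fun y => F (A + vecMulVec φ y))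
  simp only [h2]
  rw [Finset.sum_comm]
  simp only [sum_shift]
  simp

lemma rank_drop (X : MM m n) (a φ : Fin m → ZMod 2) (ha : a ≠ 0) (hφ : φ ⬝ᵥ a = 1)
    (hX : ∃ w, X *ᵥ w = a) {d : ℕ} (hd : X.rank ≤ d + 1) :
    ((1 + vecMulVec a φ) * X).rank ≤ d := by
  obtain ⟨w, hw⟩ := hX
  have hlt : ((1 + vecMulVec a φ) * X).rank < X.rank := by
    have hk : LinearMap.ker X.mulVecLin < LinearMap.ker ((1 + vecMulVec a φ) * X).mulVecLin := by
      refine lt_of_le_of_ne ?_ ?_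
      · intro v hv
        rw [LinearMap.mem_ker, mulVecLin_apply] at *
        rw [← mulVec_mulVec, hv, mulVec_zero]
      · intro he
        have : w ∈ LinearMap.ker ((1 + vecMulVec a φ) * X).mulVecLin := by
          rw [LinearMap.mem_ker, mulVecLin_apply, ← mulVec_mulVec, hw, add_mulVec, one_mulVec,
            vecMulVec_mulVec, hφ]
          ext i
          have : ∀ x : ZMod 2, x + x = 0 := by decide
          simp [this]
        rw [← he, LinearMap.mem_ker, mulVecLin_apply, hw] at this
        exact ha this
    have h1 := LinearMap.finrank_range_add_finrank_ker X.mulVecLin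
    have h2 := LinearMap.finrank_range_add_finrank_ker ((1 + vecMulVec a φ) * X).mulVecLin
    have h3 := Submodule.finrank_lt_finrank_of_lt hk
    unfold Matrix.rank
    omega
  omega

lemma exists_phi (a : Fin m → ZMod 2) (ha : a ≠ 0) : ∃ φ : Fin m → ZMod 2, φ ⬝ᵥ a = 1 := by
  obtain ⟨i, hi⟩ := Function.ne_iff.mp ha
  refine ⟨Pi.single i 1, ?_⟩
  rw [single_dotProduct, one_mul]
  exact (zmod2_cases _).resolve_left hi

def Level (d : ℕ) (δ ε : ℝ) : Prop :=
  ∀ m n : ℕ, ∀ f : MM m n → ℝ, (∀ A, 0 ≤ f A) → (∀ A, f A ≤ 1) → PR m n d δ f →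
    ∀ g : MM m n → ℝ, (∀ X, g X ≠ 0 → X.rank ≤ d) →
      ∑ A, f A * (GG g A) ^ 2 ≤ ε * ∑ A, (GG g A) ^ 2

lemma zoom_step {d : ℕ} {δ ε : ℝ} (IH : Level d δ ε) (f : MM m n → ℝ) (f0 : ∀ A, 0 ≤ f A)
    (f1 : ∀ A, f A ≤ 1) (hf : PR m n (d+1) δ f) (a : Fin m → ZMod 2) (ha : a ≠ 0)
    (h : MM m n → ℝ) (hr : ∀ X, h X ≠ 0 → X.rank ≤ d + 1)
    (hh : ∀ X, h X ≠ 0 → ∃ w, X *ᵥ w = a) :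
    ∑ A, f A * (GG h A) ^ 2 ≤ ε * ∑ A, (GG h A) ^ 2 := by
  classical
  obtain ⟨φ, hφ⟩ := exists_phi a ha
  set hy : (Fin n → ZMod 2) → MM m n → ℝ := fun y Z =>
    ∑ X, if (1 + vecMulVec a φ) * X = Z then h X * chi X (vecMulVec φ y) else 0 with hhy
  have hG : ∀ y (A : MM m n), GG h ((1 + vecMulVec φ a) * A + vecMulVec φ y) = GG (hy y) A := by
    intro y A
    simp only [GG, hhy, Finset.sum_mul]
    rw [Finset.sum_comm]
    refine Finset.sum_congr rfl fun X _ => ?_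
    simp only [ite_mul, zero_mul]
    rw [Finset.sum_ite_eq]
    simp only [Finset.mem_univ, if_true]
    rw [chi_add_right]
    have : chi ((1 + vecMulVec a φ) * X) A = chi X ((1 + vecMulVec φ a) * A) := by
      rw [chi, ip_mul_left, transpose_add, transpose_one, transpose_vecMulVec, chi]
    rw [this]; ring
  have key : ∀ y, ∑ A : MM m n, f ((1 + vecMulVec φ a) * A + vecMulVec φ y) *
      (GG h ((1 + vecMulVec φ a) * A + vecMulVec φ y)) ^ 2
      ≤ ε * ∑ A : MM m n, (GG h ((1 + vecMulVec φ a) * A + vecMulVec φ y)) ^ 2 := by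
    intro y
    simp only [hG]
    refine IH m n (fun A => f ((1 + vecMulVec φ a) * A + vecMulVec φ y)) (fun _ => f0 _)
      (fun _ => f1 _) (PR_zoom hf a φ _) (hy y) ?_
    intro Z hZ
    obtain ⟨X, -, hX⟩ := Finset.exists_ne_zero_of_sum_ne_zero hZ
    have hX1 : (1 + vecMulVec a φ) * X = Z := by
      by_contra hc; simp [hc] at hX
    have hX2 : h X ≠ 0 := by
      intro hc; simp [hc] at hX
    rw [← hX1]
    exact rank_drop X a φ ha hφ (hh X hX2) (hr X hX2)
  have tot := Finset.sum_le_sum (s := Finset.univ) (fun y _ => key y)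
  rw [← Finset.mul_sum, avg_zoom a φ (fun B => f B * (GG h B) ^ 2),
    avg_zoom a φ (fun B => (GG h B) ^ 2)] at tot
  have hc : (0:ℝ) < (Fintype.card (Fin n → ZMod 2) : ℝ) := by exact_mod_cast Fintype.card_pos
  refine le_of_mul_le_mul_left ?_ hc
  linarith

lemma zoom_step' {d : ℕ} {δ ε : ℝ} (IH : Level d δ ε) (f : MM m n → ℝ) (f0 : ∀ A, 0 ≤ f A)
    (f1 : ∀ A, f A ≤ 1) (hf : PR m n (d+1) δ f) (a : Fin n → ZMod 2) (ha : a ≠ 0)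
    (h : MM m n → ℝ) (hr : ∀ X, h X ≠ 0 → X.rank ≤ d + 1)
    (hh : ∀ X, h X ≠ 0 → ∃ w, Xᵀ *ᵥ w = a) :
    ∑ A, f A * (GG h A) ^ 2 ≤ ε * ∑ A, (GG h A) ^ 2 := by
  have hG : ∀ A : MM n m, GG (fun X => h Xᵀ) A = GG h Aᵀ := by
    intro A
    unfold GG
    rw [← sum_transpose (m := m)]
    refine Finset.sum_congr rfl fun X _ => ?_
    simp only [chi]
    rw [← ip_transpose X A]
  have := zoom_step IH (fun A => f Aᵀ) (fun _ => f0 _) (fun _ => f1 _) (PR_transpose hf) a ha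
    (fun X => h Xᵀ) (fun X hX => by rw [← rank_transpose]; exact hr _ hX)
    (fun X hX => by simpa using hh _ hX)
  simp only [hG] at this
  rw [sum_transpose (fun A => f A * (GG h A) ^ 2), sum_transpose (fun A => (GG h A) ^ 2)] at this
  exact this

open Classical in
noncomputable def TT (X : MM m n) : Finset ((Fin m → ZMod 2) ⊕ (Fin n → ZMod 2)) :=
  (Finset.univ.filter (fun a => a ≠ 0 ∧ ∃ w, X *ᵥ w = a)).disjSum
    (Finset.univ.filter (fun b => b ≠ 0 ∧ ∃ w, Xᵀ *ᵥ w = b))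

lemma mem_TT_inl (X : MM m n) (a) : Sum.inl a ∈ TT X ↔ a ≠ 0 ∧ ∃ w, X *ᵥ w = a := by
  simp [TT]
lemma mem_TT_inr (X : MM m n) (a) : Sum.inr a ∈ TT X ↔ a ≠ 0 ∧ ∃ w, Xᵀ *ᵥ w = a := by
  simp [TT]

lemma card_range (X : MM m n) : Fintype.card (Set.range (X *ᵥ ·)) = 2 ^ X.rank := by
  have h := Module.card_eq_pow_finrank (K := ZMod 2) (V := LinearMap.range X.mulVecLin)
  rw [ZMod.card] at h
  rw [Matrix.rank, ← h]
  exact Fintype.card_congr (Equiv.refl _)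

lemma card_range_filter (X : MM m n) :
    (Finset.univ.filter (fun a => a ≠ 0 ∧ ∃ w, X *ᵥ w = a)).card ≤ 2 ^ X.rank := by
  classical
  rw [← card_range, ← Set.toFinset_card]
  apply Finset.card_le_card
  intro a ha
  simp at ha ⊢
  exact ha.2

lemma card_TT (X : MM m n) {d : ℕ} (h : X.rank ≤ d) : (TT X).card ≤ 2 ^ (d + 1) := by
  classical
  unfold TT
  rw [Finset.card_disjSum]
  have h1 := card_range_filter X
  have h2 := card_range_filter Xᵀ
  rw [rank_transpose] at h2
  have h3 : 2 ^ X.rank ≤ 2 ^ d := Nat.pow_le_pow_right (by norm_num) h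
  rw [pow_succ]
  convert (show _ ≤ 2 ^ d * 2 from ?_) using 1
  convert (show (Finset.univ.filter (fun a => a ≠ 0 ∧ ∃ w, X *ᵥ w = a)).card + 
    (Finset.univ.filter (fun a => a ≠ 0 ∧ ∃ w, Xᵀ *ᵥ w = a)).card ≤ 2 ^ d * 2 from by omega)

def Good (d : ℕ) (X Y : MM m n) : Prop :=
  X.rank ≤ d ∧ Y.rank ≤ d ∧ Disjoint (TT X) (TT Y)

lemma good_ker {d : ℕ} {X Z : MM m n} (h : Good d X Z) (w : Fin n → ZMod 2)
    (hw : (X + Z) *ᵥ w = 0) : X *ᵥ w = 0 := by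
  by_contra hc
  have e : X *ᵥ w = Z *ᵥ w := by
    rw [add_mulVec] at hw
    have : ∀ x y : ZMod 2, x + y = 0 → x = y := by decide
    ext i
    exact this _ _ (congrFun hw i)
  refine Finset.disjoint_left.mp h.2.2 ((mem_TT_inl X (X *ᵥ w)).2 ⟨hc, w, rfl⟩)
    ((mem_TT_inl Z (X *ᵥ w)).2 ⟨hc, w, e.symm⟩)

lemma good_ker' {d : ℕ} {X Z : MM m n} (h : Good d X Z) (w : Fin m → ZMod 2)
    (hw : (X + Z)ᵀ *ᵥ w = 0) : Xᵀ *ᵥ w = 0 := by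
  by_contra hc
  have e : Xᵀ *ᵥ w = Zᵀ *ᵥ w := by
    rw [transpose_add, add_mulVec] at hw
    have : ∀ x y : ZMod 2, x + y = 0 → x = y := by decide
    ext i
    exact this _ _ (congrFun hw i)
  refine Finset.disjoint_left.mp h.2.2 ((mem_TT_inr X (Xᵀ *ᵥ w)).2 ⟨hc, w, rfl⟩)
    ((mem_TT_inr Z (Xᵀ *ᵥ w)).2 ⟨hc, w, e.symm⟩)

def KK (d : ℕ) : ℕ := 2 ^ (2 ^ (2 * d) * 2 ^ (2 * d))

open Classical in
lemma good_count (d : ℕ) (Y : MM m n) :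
    (Finset.univ.filter (fun X => Good d X (X + Y))).card ≤ KK d := by
  by_cases hne : (Finset.univ.filter (fun X => Good d X (X + Y))).Nonempty
  swap
  · rw [Finset.not_nonempty_iff_eq_empty] at hne
    rw [hne]; simp
  obtain ⟨X0, hX0⟩ := hne
  have hX0 : Good d X0 (X0 + Y) := by simpa using hX0
  have hrY : Y.rank ≤ 2 * d := by
    rw [← add_add_self X0 Y]
    have := rank_add_le X0 (X0 + Y)
    have := hX0.1
    have := hX0.2.1
    omega
  let s : Set.range (Y *ᵥ ·) → (Fin n → ZMod 2) := fun v => v.2.choose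
  have hs : ∀ v, Y *ᵥ (s v) = v.1 := fun v => v.2.choose_spec
  let t : Set.range (Yᵀ *ᵥ ·) → (Fin m → ZMod 2) := fun v => v.2.choose
  have ht : ∀ v, Yᵀ *ᵥ (t v) = v.1 := fun v => v.2.choose_spec
  let Φ : MM m n → (Set.range (Y *ᵥ ·) × Set.range (Yᵀ *ᵥ ·) → ZMod 2) :=
    fun X p => t p.2 ⬝ᵥ X *ᵥ (s p.1)
  have val : ∀ X, Good d X (X + Y) → ∀ u w,
      u ⬝ᵥ X *ᵥ w = Φ X (⟨Y *ᵥ w, w, rfl⟩, ⟨Yᵀ *ᵥ u, u, rfl⟩) := by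
    intro X hX u w
    have e1 : X *ᵥ w = X *ᵥ (s ⟨Y *ᵥ w, w, rfl⟩) := by
      have := good_ker hX (w - s ⟨Y *ᵥ w, w, rfl⟩) (by
        rw [add_add_self, mulVec_sub, hs, sub_self])
      rwa [mulVec_sub, sub_eq_zero] at this
    have e2 : Xᵀ *ᵥ u = Xᵀ *ᵥ (t ⟨Yᵀ *ᵥ u, u, rfl⟩) := by
      have := good_ker' hX (u - t ⟨Yᵀ *ᵥ u, u, rfl⟩) (by
        rw [add_add_self, mulVec_sub, ht, sub_self])
      rwa [mulVec_sub, sub_eq_zero] at this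
    simp only [Φ]
    rw [e1, dotProduct_mulVec, dotProduct_mulVec, ← mulVec_transpose, ← mulVec_transpose, e2]
  have inj : Set.InjOn Φ (Finset.univ.filter (fun X => Good d X (X + Y)) : Finset (MM m n)) := by
    intro X hX X' hX' he
    have hX : Good d X (X + Y) := by simpa using hX
    have hX' : Good d X' (X' + Y) := by simpa using hX'
    ext i j
    have h1 := val X hX (Pi.single i 1) (Pi.single j 1)
    have h2 := val X' hX' (Pi.single i 1) (Pi.single j 1)
    rw [he, ← h2] at h1
    simpa using h1
  have := Finset.card_le_card_of_injOn Φ (t := Finset.univ) (fun _ _ => Finset.mem_univ _) inj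
  refine this.trans ?_
  rw [Finset.card_univ, Fintype.card_fun, Fintype.card_prod, ZMod.card, card_range, card_range,
    rank_transpose]
  unfold KK
  have : 2 ^ Y.rank ≤ 2 ^ (2 * d) := Nat.pow_le_pow_right (by norm_num) hrY
  exact Nat.pow_le_pow_right (by norm_num) (Nat.mul_le_mul this this)

open Classical in
/-- Transversal part of the square. -/
noncomputable def qq (d : ℕ) (g : MM m n → ℝ) (Y : MM m n) : ℝ :=
  ∑ X, if Good d X (X + Y) then g X * g (X + Y) else 0

lemma sum_shift_left (b : MM m n) (F : MM m n → ℝ) : ∑ a, F (b + a) = ∑ a, F a := by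
  simp only [add_comm b, sum_shift]

lemma qq_sq (d : ℕ) (g : MM m n → ℝ) :
    ∑ Y, (qq d g Y) ^ 2 ≤ (KK d : ℝ) * (∑ X, g X ^ 2) ^ 2 := by
  classical
  have h1 : ∀ Y, (qq d g Y) ^ 2 ≤ (KK d : ℝ) * ∑ X, g X ^ 2 * g (X + Y) ^ 2 := by
    intro Y
    unfold qq
    rw [← Finset.sum_filter]
    refine (sq_sum_le_card_mul_sum_sq).trans ?_
    have hc : ((Finset.univ.filter (fun X => Good d X (X + Y))).card : ℝ) ≤ KK d := by
      exact_mod_cast good_count d Y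
    refine mul_le_mul hc ?_ (Finset.sum_nonneg fun _ _ => sq_nonneg _) (by positivity)
    simp only [mul_pow]
    exact Finset.sum_le_sum_of_subset_of_nonneg (Finset.subset_univ _)
      (fun _ _ _ => by positivity)
  refine (Finset.sum_le_sum fun Y _ => h1 Y).trans (le_of_eq ?_)
  rw [← Finset.mul_sum, Finset.sum_comm]
  simp only [← Finset.mul_sum, sum_shift_left _ (fun Z => g Z ^ 2)]
  rw [← Finset.sum_mul, sq]

open Classical in
noncomputable def gS (g : MM m n → ℝ) (S : Finset ((Fin m → ZMod 2) ⊕ (Fin n → ZMod 2)))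
    (X : MM m n) : ℝ := if S ⊆ TT X then g X else 0

lemma ie (T T' : Finset ((Fin m → ZMod 2) ⊕ (Fin n → ZMod 2))) :
    (∑ S : Finset ((Fin m → ZMod 2) ⊕ (Fin n → ZMod 2)),
      if S ⊆ T ∧ S ⊆ T' then (-1 : ℝ) ^ S.card else 0) = if Disjoint T T' then 1 else 0 := by
  classical
  have h := Finset.sum_powerset_neg_one_pow_card (x := T ∩ T')
  have h' : (∑ S ∈ (T ∩ T').powerset, (-1 : ℝ) ^ S.card) = if T ∩ T' = ∅ then 1 else 0 := by
    exact_mod_cast congrArg (Int.cast : ℤ → ℝ) h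
  rw [← Finset.sum_filter]
  simp only [Finset.disjoint_iff_inter_eq_empty]
  rw [← h']
  refine Finset.sum_congr ?_ fun _ _ => rfl
  ext S
  rw [Finset.mem_filter, Finset.mem_powerset, Finset.subset_inter_iff]
  simp

lemma GG_qq (d : ℕ) (g : MM m n → ℝ) (hg : ∀ X, g X ≠ 0 → X.rank ≤ d) (A : MM m n) :
    GG (qq d g) A = ∑ S, (-1 : ℝ) ^ S.card * (GG (gS g S) A) ^ 2 := by
  classical
  have hR : ∀ S, (-1 : ℝ) ^ S.card * (GG (gS g S) A) ^ 2 =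
      ∑ X, ∑ Z, (g X * g Z * chi X A * chi Z A) *
        (if S ⊆ TT X ∧ S ⊆ TT Z then (-1 : ℝ) ^ S.card else 0) := by
    intro S
    rw [sq, GG, Finset.sum_mul_sum, Finset.mul_sum]
    refine Finset.sum_congr rfl fun X _ => ?_
    rw [Finset.mul_sum]
    refine Finset.sum_congr rfl fun Z _ => ?_
    unfold gS
    by_cases h1 : S ⊆ TT X <;> by_cases h2 : S ⊆ TT Z <;> simp [h1, h2]
    ring
  simp only [hR]
  rw [Finset.sum_comm]
  have : ∀ X : MM m n, ∑ S, ∑ Z, (g X * g Z * chi X A * chi Z A) *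
        (if S ⊆ TT X ∧ S ⊆ TT Z then (-1 : ℝ) ^ S.card else 0)
      = ∑ Z, (g X * g Z * chi X A * chi Z A) * if Disjoint (TT X) (TT Z) then 1 else 0 := by
    intro X
    rw [Finset.sum_comm]
    simp only [← Finset.mul_sum, ie]
  simp only [this]
  unfold GG qq
  simp only [Finset.sum_mul]
  rw [Finset.sum_comm]
  refine Finset.sum_congr rfl fun X _ => ?_
  rw [← sum_shift_left X]
  refine Finset.sum_congr rfl fun Z _ => ?_
  rw [add_add_self]
  by_cases hX : g X = 0
  · simp [hX]
  by_cases hZ : g Z = 0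
  · simp [hZ]
  have hG : Good d X Z ↔ Disjoint (TT X) (TT Z) := by
    simp [Good, hg X hX, hg Z hZ]
  simp only [hG, chi_add_left]
  split_ifs <;> ring

lemma gS_sum {d : ℕ} (g : MM m n → ℝ) (hg : ∀ X, g X ≠ 0 → X.rank ≤ d) :
    ∑ S, ∑ A, (GG (gS g S) A) ^ 2 ≤ (2 : ℝ) ^ (2 ^ (d+1)) * ∑ A, (GG g A) ^ 2 := by
  classical
  simp only [sum_GG_sq]
  rw [← Finset.mul_sum, Finset.sum_comm, mul_left_comm]
  refine mul_le_mul_of_nonneg_left ?_ NN_pos.le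
  rw [Finset.mul_sum]
  refine Finset.sum_le_sum fun X _ => ?_
  by_cases hX : g X = 0
  · simp [gS, hX]
  have : ∑ S, gS g S X ^ 2 = (2:ℝ) ^ (TT X).card * g X ^ 2 := by
    unfold gS
    simp only [ite_pow]
    have hz : (0:ℝ) ^ 2 = 0 := by norm_num
    rw [hz, ← Finset.sum_filter]
    have : (Finset.univ.filter (fun S => S ⊆ TT X)) = (TT X).powerset := by ext; simp
    rw [Finset.sum_const, this, Finset.card_powerset]
    simp
  rw [this]
  refine mul_le_mul_of_nonneg_right ?_ (sq_nonneg _)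
  exact pow_le_pow_right₀ (by norm_num) (card_TT X (hg X hX))

noncomputable def cc : ℕ → ℝ
  | 0 => 1
  | d+1 => KK (d+1) + (2 : ℝ) ^ (2 ^ (d+2)) * cc d

lemma cc_pos (d : ℕ) : 0 < cc d := by
  induction d with
  | zero => simp [cc]
  | succ d ih => simp only [cc]; positivity

theorem level (s : ℝ) (hs0 : 0 ≤ s) (hs1 : s ≤ 1) (d : ℕ) : Level d (s ^ 2) (cc d * s) := by
  classical
  induction d with
  | zero =>
    intro m n f f0 f1 hf g hg
    have hG : ∀ A, GG g A = g 0 := by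
      intro A
      unfold GG
      rw [Finset.sum_eq_single 0]
      · simp [chi, ip, sgn_zero]
      · intro X _ hX
        have : g X = 0 := by
          by_contra hc
          have := hg X hc
          exact hX (rank_eq_zero' X (Nat.le_zero.mp this))
        simp [this]
      · simp
    simp only [hG]
    rw [← Finset.sum_mul]
    have := PR_sum hf
    have h2 : ∑ A, f A ≤ s * NN m n :=
      this.trans (mul_le_mul_of_nonneg_right (by nlinarith) NN_pos.le)
    simp only [cc, one_mul]
    rw [Finset.sum_const, Finset.card_univ, nsmul_eq_mul, ← mul_assoc]
    exact mul_le_mul_of_nonneg_right h2 (sq_nonneg _)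
  | succ d IH =>
    intro m n f f0 f1 hf g hg
    have hgS : ∀ S X, gS g S X ≠ 0 → g X ≠ 0 ∧ S ⊆ TT X := by
      intro S X h
      unfold gS at h
      by_cases hc : S ⊆ TT X
      · simp [hc] at h; exact ⟨h, hc⟩
      · simp [hc] at h
    have stepS : ∀ S : Finset ((Fin m → ZMod 2) ⊕ (Fin n → ZMod 2)), S ≠ ∅ →
        ∑ A, f A * (GG (gS g S) A) ^ 2 ≤ (cc d * s) * ∑ A, (GG (gS g S) A) ^ 2 := by
      intro S hS
      obtain ⟨x, hx⟩ := Finset.nonempty_iff_ne_empty.mpr hS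
      by_cases hz : ∀ X, gS g S X = 0
      · have : ∀ A, GG (gS g S) A = 0 := by intro A; simp [GG, hz]
        simp [this]
      push Not at hz
      obtain ⟨X0, hX0⟩ := hz
      have hx0 := (hgS S X0 hX0).2 hx
      rcases x with a | b
      · refine zoom_step IH f f0 f1 hf a ((mem_TT_inl X0 a).1 hx0).1 _
          (fun X hX => hg X (hgS S X hX).1) (fun X hX => ?_)
        exact ((mem_TT_inl X a).1 ((hgS S X hX).2 hx)).2
      · refine zoom_step' IH f f0 f1 hf b ((mem_TT_inr X0 b).1 hx0).1 _
          (fun X hX => hg X (hgS S X hX).1) (fun X hX => ?_)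
        exact ((mem_TT_inr X b).1 ((hgS S X hX).2 hx)).2
    have g0 : gS g ∅ = g := by ext X; simp [gS]
    -- pointwise
    have pt : ∀ A, (GG g A) ^ 2 ≤ GG (qq (d+1) g) A +
        ∑ S ∈ Finset.univ.erase ∅, (GG (gS g S) A) ^ 2 := by
      intro A
      rw [GG_qq (d+1) g hg A, ← Finset.add_sum_erase _ _ (Finset.mem_univ ∅), g0]
      have : -∑ S ∈ Finset.univ.erase ∅, (GG (gS g S) A) ^ 2 ≤
          ∑ S ∈ Finset.univ.erase ∅, (-1 : ℝ) ^ S.card * (GG (gS g S) A) ^ 2 := by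
        rw [← Finset.sum_neg_distrib]
        refine Finset.sum_le_sum fun S _ => ?_
        have := sq_nonneg (GG (gS g S) A)
        rcases neg_one_pow_eq_or ℝ S.card with h | h <;> rw [h] <;> linarith
      simp only [Finset.card_empty, pow_zero, one_mul]
      linarith
    have hgood : ∑ A, f A * GG (qq (d+1) g) A ≤ (KK (d+1) : ℝ) * s * ∑ A, (GG g A) ^ 2 := by
      have hcs := Finset.sum_mul_sq_le_sq_mul_sq Finset.univ f (GG (qq (d+1) g))
      have hf2 : ∑ A, f A ^ 2 ≤ s ^ 2 * NN m n := by
        refine le_trans (Finset.sum_le_sum fun A _ => ?_) (PR_sum hf)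
        nlinarith [f0 A, f1 A]
      have hK : (1:ℝ) ≤ KK (d+1) := by
        exact_mod_cast Nat.one_le_two_pow
      have hq : ∑ A, (GG (qq (d+1) g) A) ^ 2 ≤
          NN m n * ((KK (d+1) : ℝ) ^ 2 * (∑ X, g X ^ 2) ^ 2) := by
        rw [sum_GG_sq]
        refine mul_le_mul_of_nonneg_left ?_ NN_pos.le
        refine (qq_sq (d+1) g).trans (mul_le_mul_of_nonneg_right ?_ (sq_nonneg _))
        nlinarith
      rw [sum_GG_sq]
      refine abs_le_of_sq_le_sq' (a := _) ?_ ?_ |>.2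
      · refine hcs.trans ((mul_le_mul hf2 hq (Finset.sum_nonneg fun _ _ => sq_nonneg _)
          (mul_nonneg (sq_nonneg _) NN_pos.le)).trans (le_of_eq ?_))
        ring
      · have := NN_pos (m := m) (n := n)
        have : 0 ≤ ∑ X, g X ^ 2 := Finset.sum_nonneg fun _ _ => sq_nonneg _
        positivity
    calc ∑ A, f A * (GG g A) ^ 2
        ≤ ∑ A, f A * (GG (qq (d+1) g) A + ∑ S ∈ Finset.univ.erase ∅, (GG (gS g S) A) ^ 2) :=
          Finset.sum_le_sum fun A _ => mul_le_mul_of_nonneg_left (pt A) (f0 A)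
      _ = ∑ A, f A * GG (qq (d+1) g) A +
          ∑ S ∈ Finset.univ.erase ∅, ∑ A, f A * (GG (gS g S) A) ^ 2 := by
          rw [Finset.sum_comm, ← Finset.sum_add_distrib]
          refine Finset.sum_congr rfl fun A _ => ?_
          rw [mul_add, Finset.mul_sum]
      _ ≤ (KK (d+1) : ℝ) * s * ∑ A, (GG g A) ^ 2 +
          ∑ S ∈ Finset.univ.erase ∅, (cc d * s) * ∑ A, (GG (gS g S) A) ^ 2 := by
          refine add_le_add hgood (Finset.sum_le_sum fun S hS => stepS S ?_)
          exact (Finset.mem_erase.mp hS).1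
      _ ≤ (KK (d+1) : ℝ) * s * ∑ A, (GG g A) ^ 2 +
          (cc d * s) * ((2 : ℝ) ^ (2 ^ (d+2)) * ∑ A, (GG g A) ^ 2) := by
          rw [← Finset.mul_sum]
          refine add_le_add le_rfl (mul_le_mul_of_nonneg_left ?_ (mul_nonneg (cc_pos d).le hs0))
          refine le_trans ?_ (gS_sum g hg)
          exact Finset.sum_le_sum_of_subset_of_nonneg (Finset.subset_univ _)
            (fun _ _ _ => Finset.sum_nonneg fun _ _ => sq_nonneg _)
      _ = _ := by simp only [cc]; ring

lemma ginv (Q : MM m n) : ∃ Q' : MM n m, Q * Q' * Q = Q := by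
  obtain ⟨g, hg⟩ := Q.mulVecLin.rangeRestrict.exists_rightInverse_of_surjective
    Q.mulVecLin.range_rangeRestrict
  obtain ⟨G, hG⟩ := LinearMap.exists_extend g
  refine ⟨LinearMap.toMatrix' G, ?_⟩
  have key : ∀ v, Q *ᵥ (G (Q *ᵥ v)) = Q *ᵥ v := by
    intro v
    have h1 := LinearMap.congr_fun hG (Q.mulVecLin.rangeRestrict v)
    have h2 := LinearMap.congr_fun hg (Q.mulVecLin.rangeRestrict v)
    have h3 := congrArg Subtype.val h2
    simp at h1 h3
    rw [h1]
    exact h3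
  apply Matrix.toLin'.injective
  ext1 j
  ext1
  have := key (Pi.single j 1)
  simpa [Matrix.toLin'_mul] using this
 
lemma factor (P : MM m m) (Q : MM n n) (D : MM m n) (h1 : ∀ x, Q *ᵥ x = 0 → D *ᵥ x = 0)
    (h2 : ∀ x, Pᵀ *ᵥ x = 0 → Dᵀ *ᵥ x = 0) : ∃ E : MM m n, D = P * E * Q := by
  have aux : ∀ {a b : ℕ} (R : MM b b) (D : MM a b), (∀ x, R *ᵥ x = 0 → D *ᵥ x = 0) →
      ∃ R' : MM b b, D = D * R' * R := by
    intro a b R D h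
    obtain ⟨R', hR⟩ := ginv R
    refine ⟨R', ?_⟩
    ext i j
    have := h (Pi.single j 1 - (R' * R) *ᵥ (Pi.single j 1)) (by
      rw [mulVec_sub, mulVec_mulVec, ← Matrix.mul_assoc, hR, sub_self])
    rw [mulVec_sub, sub_eq_zero, mulVec_mulVec, ← Matrix.mul_assoc] at this
    have := congrFun this i
    simpa using this
  obtain ⟨Q', hQ⟩ := aux Q D h1
  obtain ⟨P', hP⟩ := aux Pᵀ Dᵀ h2
  have hP2 : D = P * P'ᵀ * D := by
    have := congrArg Matrix.transpose hP
    simpa [Matrix.mul_assoc] using this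
  refine ⟨P'ᵀ * D * Q', ?_⟩
  calc D = P * P'ᵀ * (D * Q' * Q) := by rw [← hQ]; exact hP2
    _ = _ := by simp only [Matrix.mul_assoc]

lemma mem_foldr {α : Type*} [Fintype α] [DecidableEq α] (L : List (Finset α)) (x : α) :
    x ∈ L.foldr (· ∩ ·) Finset.univ ↔ ∀ S ∈ L, x ∈ S := by
  induction L with
  | nil => simp
  | cons a L ih => simp [ih]

lemma ker_basis {p : ℕ} (R : MM p n) (D : MM m n) :
    (∀ x, R *ᵥ x = 0 → D *ᵥ x = 0) ↔
    ∀ i, D *ᵥ ((Module.finBasis (ZMod 2) (LinearMap.ker R.mulVecLin)) i : Fin n → ZMod 2) = 0 := by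
  constructor
  · intro h i
    exact h _ (LinearMap.mem_ker.1 (Module.finBasis (ZMod 2) (LinearMap.ker R.mulVecLin) i).2)
  · intro h x hx
    have e : D.mulVecLin ∘ₗ (LinearMap.ker R.mulVecLin).subtype = 0 :=
      (Module.finBasis (ZMod 2) (LinearMap.ker R.mulVecLin)).ext (fun i => by simpa using h i)
    exact LinearMap.congr_fun e ⟨x, by simpa using hx⟩

lemma finrank_ker' (R : MM m n) :
    Module.finrank (ZMod 2) (LinearMap.ker R.mulVecLin) + R.rank = n := by
  have := LinearMap.finrank_range_add_finrank_ker R.mulVecLin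
  rw [Module.finrank_fin_fun] at this
  unfold Matrix.rank
  omega

lemma extract (k : ℕ) (δ : ℝ) (𝒜 : Finset (MM m n))
    (h : ¬ PR m n k δ (fun A => if A ∈ 𝒜 then 1 else 0)) :
    ∃ C : Finset (MM m n), C.Nonempty ∧
      (∃ L : List (Finset (MM m n)), L.length ≤ k ∧ (∀ S ∈ L, IsBasic m n S) ∧
        C = L.foldr (· ∩ ·) Finset.univ) ∧ δ * C.card ≤ ((𝒜 ∩ C).card : ℝ) := by
  unfold PR at h
  push Not at h
  obtain ⟨P, Q, B, hk, hlt⟩ := h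
  let b1 := Module.finBasis (ZMod 2) (LinearMap.ker Q.mulVecLin)
  let b2 := Module.finBasis (ZMod 2) (LinearMap.ker Pᵀ.mulVecLin)
  let L1 : List (Finset (MM m n)) := List.ofFn (fun i =>
    Finset.univ.filter (fun A : MM m n => A.mulVec (b1 i : Fin n → ZMod 2) = B *ᵥ (b1 i)))
  let L2 : List (Finset (MM m n)) := List.ofFn (fun i =>
    Finset.univ.filter (fun A : MM m n => A.transpose.mulVec (b2 i : Fin m → ZMod 2) = Bᵀ *ᵥ (b2 i)))
  have hmem : ∀ D, D ∈ (L1 ++ L2).foldr (· ∩ ·) Finset.univ ↔ ∃ E : MM m n, D = P * E * Q + B := by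
    intro D
    rw [mem_foldr]
    have e1 : (∀ S ∈ L1 ++ L2, D ∈ S) ↔
        (∀ i, (D - B) *ᵥ (b1 i : Fin n → ZMod 2) = 0) ∧
        (∀ i, (D - B)ᵀ *ᵥ (b2 i : Fin m → ZMod 2) = 0) := by
      simp [L1, L2, List.mem_append, or_imp, forall_and, List.mem_ofFn, sub_mulVec, sub_eq_zero]
    rw [e1, ← ker_basis Q (D - B), ← ker_basis Pᵀ (D - B)ᵀ]
    constructor
    · rintro ⟨h1, h2⟩
      obtain ⟨E, hE⟩ := factor P Q (D - B) h1 h2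
      exact ⟨E, by rw [← hE]; simp⟩
    · rintro ⟨E, rfl⟩
      constructor
      · intro x hx
        simp [← mulVec_mulVec, hx]
      · intro x hx
        simp [← mulVec_mulVec, hx]
  set C := (L1 ++ L2).foldr (· ∩ ·) Finset.univ with hC
  refine ⟨C, ⟨B, (hmem B).2 ⟨0, by simp⟩⟩, ⟨L1 ++ L2, ?_, ?_, rfl⟩, ?_⟩
  · have h1 := finrank_ker' Q
    have h2 := finrank_ker' Pᵀ
    rw [rank_transpose] at h2
    simp only [L1, L2, List.length_append, List.length_ofFn]
    omega
  · intro S hS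
    rw [List.mem_append] at hS
    rcases hS with hS | hS
    · obtain ⟨i, rfl⟩ := (List.mem_ofFn' _ _).1 hS
      refine Or.inl ⟨b1 i, ?_, _, rfl⟩
      simpa using b1.ne_zero i
    · obtain ⟨i, rfl⟩ := (List.mem_ofFn' _ _).1 hS
      refine Or.inr ⟨b2 i, ?_, _, rfl⟩
      simpa using b2.ne_zero i
  · -- uniform fibres
    set K : ℝ := ∑ A : MM m n, if P * A * Q = 0 then (1:ℝ) else 0 with hK
    have fib : ∀ D ∈ C, (∑ A : MM m n, if P * A * Q + B = D then (1:ℝ) else 0) = K := by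
      intro D hD
      obtain ⟨E, rfl⟩ := (hmem D).1 hD
      rw [← sum_shift E]
      refine Finset.sum_congr rfl fun A _ => ?_
      simp [Matrix.mul_add, Matrix.add_mul]
    have gen : ∀ F : MM m n → ℝ, ∑ A : MM m n, F (P * A * Q + B) = K * ∑ D ∈ C, F D := by
      intro F
      have : ∀ A : MM m n, F (P * A * Q + B) =
          ∑ D ∈ C, if P * A * Q + B = D then F D else 0 := by
        intro A
        rw [Finset.sum_ite_eq, if_pos ((hmem _).2 ⟨A, rfl⟩)]
      simp only [this]
      rw [Finset.sum_comm, Finset.mul_sum]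
      refine Finset.sum_congr rfl fun D hD => ?_
      rw [← fib D hD, Finset.sum_mul]
      simp
    have g1 := gen (fun _ => 1)
    have g2 := gen (fun A => if A ∈ 𝒜 then 1 else 0)
    rw [g2] at hlt
    have hN : NN m n = K * C.card := by
      rw [NN]; simpa using g1
    rw [hN] at hlt
    have hKpos : 0 < K := by
      have h0 : 0 ≤ K := Finset.sum_nonneg fun _ _ => by positivity
      have := NN_pos (m := m) (n := n)
      rw [hN] at this
      rcases h0.eq_or_lt with h | h
      · rw [← h] at this; simp at this
      · exact h
    have e : (∑ D ∈ C, if D ∈ 𝒜 then (1:ℝ) else 0) = ((𝒜 ∩ C).card : ℝ) := by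
      rw [← Finset.sum_filter, Finset.sum_const, nsmul_eq_mul, mul_one]
      congr 2
      ext; simp [and_comm]
    rw [e] at hlt
    refine le_of_mul_le_mul_left ?_ hKpos
    linarith

noncomputable def fhat (f : MM m n → ℝ) (X : MM m n) : ℝ := (∑ A, f A * chi X A) / NN m n

lemma inversion (f : MM m n → ℝ) (A : MM m n) : GG (fhat f) A = f A := by
  unfold GG fhat
  have : ∀ X : MM m n, (∑ B, f B * chi X B) / NN m n * chi X A =
      ∑ B, (f B / NN m n) * (chi B X * chi A X) := by
    intro X
    rw [Finset.sum_div, Finset.sum_mul]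
    refine Finset.sum_congr rfl fun B _ => ?_
    rw [chi_comm X B, chi_comm X A]; ring
  simp only [this]
  rw [Finset.sum_comm]
  simp only [← Finset.mul_sum, chi_orth]
  simp [NN_pos.ne']

lemma parseval (g h : MM m n → ℝ) : ∑ A, GG g A * GG h A = NN m n * ∑ X, g X * h X := by
  have h1 := sum_GG_sq (fun X => g X + h X)
  have h2 := sum_GG_sq g
  have h3 := sum_GG_sq h
  have e : ∀ A, GG (fun X => g X + h X) A = GG g A + GG h A := by
    intro A; simp [GG, add_mul, Finset.sum_add_distrib]
  simp only [e, add_sq, Finset.sum_add_distrib, mul_assoc, ← Finset.mul_sum] at h1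
  linarith

lemma corr (f : MM m n → ℝ) (R : MM m n) :
    ∑ A, f A * f (A + R) = NN m n * ∑ X, fhat f X ^ 2 * chi X R := by
  have e : ∀ A, f (A + R) = GG (fun X => fhat f X * chi X R) A := by
    intro A
    rw [← inversion f]
    refine Finset.sum_congr rfl fun X _ => ?_
    rw [chi_add_right]; ring
  have : ∑ A, f A * f (A + R) = ∑ A, GG (fhat f) A * GG (fun X => fhat f X * chi X R) A := by
    refine Finset.sum_congr rfl fun A _ => ?_
    rw [e, inversion]
  rw [this, parseval]
  congr 1
  refine Finset.sum_congr rfl fun X _ => by ring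

lemma sum_sgn_dot (z : Fin m → ZMod 2) :
    ∑ u : Fin m → ZMod 2, sgn (u ⬝ᵥ z) = if z = 0 then (2:ℝ) ^ m else 0 := by
  split_ifs with h
  · subst h; simp [sgn_zero]
  · obtain ⟨φ, hφ⟩ := exists_phi z h
    have key := sum_shift φ (fun u => sgn (u ⬝ᵥ z))
    simp only [add_dotProduct, sgn_add, hφ, sgn_one] at key
    rw [← Finset.sum_mul] at key
    linarith

lemma sum_all (X : MM m n) :
    ∑ u : Fin m → ZMod 2, ∑ v : Fin n → ZMod 2, chi X (vecMulVec u v)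
      = (2:ℝ) ^ m * 2 ^ n / 2 ^ X.rank := by
  rw [Finset.sum_comm]
  simp only [chi, ip_vec, sum_sgn_dot]
  rw [← Finset.sum_filter, Finset.sum_const, nsmul_eq_mul]
  have hc : (Finset.univ.filter (fun v => X *ᵥ v = 0)).card
      = 2 ^ Module.finrank (ZMod 2) (LinearMap.ker X.mulVecLin) := by
    classical
    have h := Module.card_eq_pow_finrank (K := ZMod 2) (V := LinearMap.ker X.mulVecLin)
    rw [ZMod.card] at h
    rw [← h, Fintype.card_subtype]
    congr 1
    ext v
    simp [LinearMap.mem_ker]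
  rw [hc]
  have h := finrank_ker' X
  rw [eq_div_iff (by positivity)]
  push_cast
  conv_rhs => rw [← h, pow_add]
  ring

lemma sum_nonzero (X : MM m n) (hm : 0 < m) (hn : 0 < n) :
    ∑ p ∈ Finset.univ.filter
      (fun p : (Fin m → ZMod 2) × (Fin n → ZMod 2) => p.1 ≠ 0 ∧ p.2 ≠ 0),
      chi X (vecMulVec p.1 p.2) ≤ (1 / 2 ^ X.rank) * (((2:ℝ) ^ m - 1) * ((2:ℝ) ^ n - 1)) := by
  rw [Finset.sum_filter, Fintype.sum_prod_type]
  have c1 : ∀ v, chi X (vecMulVec 0 v) = 1 := by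
    intro v; rw [chi, ip_vec]; simp [sgn_zero]
  have c2 : ∀ u, chi X (vecMulVec u 0) = 1 := by
    intro v; rw [chi, ip_vec]; simp [sgn_zero]
  have e : ∀ u v, (if u ≠ 0 ∧ v ≠ 0 then chi X (vecMulVec u v) else 0) =
      chi X (vecMulVec u v) - (if u = 0 then 1 else 0) - (if v = 0 then 1 else 0)
        + (if u = 0 then 1 else 0) * (if v = 0 then 1 else 0) := by
    intro u v
    by_cases hu : u = 0 <;> by_cases hv : v = 0
    · subst hu; subst hv; rw [c1]; simp
    · subst hu; rw [c1]; simp [hv]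
    · subst hv; rw [c2]; simp [hu]
    · simp [hu, hv]
  simp only [e, Finset.sum_add_distrib, Finset.sum_sub_distrib, sum_all, ← Finset.mul_sum]
  simp
  set r : ℝ := 2 ^ X.rank with hr
  have hr1 : 1 ≤ r := one_le_pow₀ (by norm_num)
  have h1 : (1:ℝ) ≤ 2 ^ m := one_le_pow₀ (by norm_num)
  have h2 : (1:ℝ) ≤ 2 ^ n := one_le_pow₀ (by norm_num)
  have hr' : r⁻¹ ≤ 1 := inv_le_one_of_one_le₀ hr1
  rw [div_eq_mul_inv]
  nlinarith

theorem main (η : ℝ) (hη : 0 < η) :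
    ∃ δ : ℝ, 0 < δ ∧ ∃ k : ℕ, 0 < k ∧
      ∀ m n : ℕ, 0 < m → 0 < n →
        ∀ A : Finset (Matrix (Fin m) (Fin n) (ZMod 2)), A.Nonempty →
          (η * A.card * (((2:ℝ) ^ m - 1) * ((2:ℝ) ^ n - 1)) ≤ (closedPairs m n A : ℝ)) →
          ∃ C : Finset (Matrix (Fin m) (Fin n) (ZMod 2)),
            C.Nonempty ∧
            (∃ L : List (Finset (Matrix (Fin m) (Fin n) (ZMod 2))),
              L.length ≤ k ∧ (∀ S ∈ L, IsBasic m n S) ∧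
              C = L.foldr (· ∩ ·) Finset.univ) ∧
            δ * C.card ≤ ((A ∩ C).card : ℝ) := by
  classical
  obtain ⟨d, hd⟩ : ∃ d : ℕ, (1 / 2 : ℝ) ^ d < η / 2 := exists_pow_lt_of_lt_one (by linarith) (by norm_num)
  set s : ℝ := min 1 (η / (4 * cc d)) with hs
  have hcc := cc_pos d
  have s0 : 0 < s := lt_min one_pos (by positivity)
  have s1 : s ≤ 1 := min_le_left _ _
  have s2 : cc d * s < η / 2 := by
    have : s ≤ η / (4 * cc d) := min_le_right _ _
    rw [le_div_iff₀ (by positivity)] at this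
    linarith
  refine ⟨s ^ 2, by positivity, d + 1, by omega, ?_⟩
  intro m n hm hn 𝒜 hne hcl
  by_cases hPR : PR m n d (s ^ 2) (fun A => if A ∈ 𝒜 then 1 else 0)
  swap
  · obtain ⟨C, h1, ⟨L, h2, h3⟩, h4⟩ := extract d (s ^ 2) 𝒜 hPR
    exact ⟨C, h1, ⟨L, by omega, h3⟩, h4⟩
  exfalso
  set f : MM m n → ℝ := fun A => if A ∈ 𝒜 then 1 else 0 with hf
  have f0 : ∀ A, 0 ≤ f A := fun A => by simp only [hf]; positivity
  have f1 : ∀ A, f A ≤ 1 := fun A => by simp only [hf]; split_ifs <;> norm_num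
  have ff : ∀ A, f A ^ 2 = f A := fun A => by simp only [hf]; split_ifs <;> norm_num
  have hμ : ∑ A, f A = 𝒜.card := by simp [hf]
  have hμpos : (0:ℝ) < 𝒜.card := by exact_mod_cast hne.card_pos
  have pars : NN m n * ∑ X, fhat f X ^ 2 = 𝒜.card := by
    rw [← sum_GG_sq, ← hμ]
    refine Finset.sum_congr rfl fun A _ => ?_
    rw [inversion, ff]
  set N1 : ℝ := ((2:ℝ) ^ m - 1) * ((2:ℝ) ^ n - 1) with hN1
  have hN1pos : 0 < N1 := by
    have h1 : (1:ℝ) < 2 ^ m := one_lt_pow₀ (by norm_num) (by omega)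
    have h2 : (1:ℝ) < 2 ^ n := one_lt_pow₀ (by norm_num) (by omega)
    exact mul_pos (by linarith) (by linarith)
  have hcp : (closedPairs m n 𝒜 : ℝ) = ∑ p ∈ Finset.univ.filter
      (fun p : (Fin m → ZMod 2) × (Fin n → ZMod 2) => p.1 ≠ 0 ∧ p.2 ≠ 0),
      ∑ A, f A * f (A + vecMulVec p.1 p.2) := by
    unfold closedPairs
    rw [Finset.card_filter, Finset.sum_product, Finset.sum_comm]
    push_cast
    refine Finset.sum_congr rfl fun p _ => ?_
    rw [← Finset.sum_subset (Finset.subset_univ 𝒜)]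
    · refine Finset.sum_congr rfl fun A hA => ?_
      simp [hf, hA]
    · intro A _ hA
      simp [hf, hA]
  have hub : (closedPairs m n 𝒜 : ℝ) ≤ NN m n * ∑ X, fhat f X ^ 2 * ((1 / 2 ^ X.rank) * N1) := by
    rw [hcp]
    simp only [corr]
    rw [← Finset.mul_sum, Finset.sum_comm]
    refine mul_le_mul_of_nonneg_left ?_ NN_pos.le
    refine Finset.sum_le_sum fun X _ => ?_
    rw [← Finset.mul_sum]
    exact mul_le_mul_of_nonneg_left (sum_nonzero X hm hn) (sq_nonneg _)
  set g : MM m n → ℝ := fun X => if X.rank ≤ d then fhat f X else 0 with hg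
  have hpt : ∀ X : MM m n, fhat f X ^ 2 * ((1 / 2 ^ X.rank) * N1)
      ≤ (g X ^ 2 + (1/2) ^ d * fhat f X ^ 2) * N1 := by
    intro X
    rw [← mul_assoc]
    refine mul_le_mul_of_nonneg_right ?_ hN1pos.le
    have hq := sq_nonneg (fhat f X)
    simp only [hg]
    split_ifs with h
    · have : (1:ℝ) / 2 ^ X.rank ≤ 1 := by
        rw [div_le_one (by positivity)]; exact one_le_pow₀ (by norm_num)
      have h3 : (0:ℝ) ≤ (1/2) ^ d * fhat f X ^ 2 := by positivity
      nlinarith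
    · have : (1:ℝ) / 2 ^ X.rank ≤ (1/2) ^ d := by
        rw [← _root_.one_div_pow]
        exact pow_le_pow_of_le_one (by norm_num) (by norm_num) (by omega)
      nlinarith
  set W : ℝ := NN m n * ∑ X, g X ^ 2 with hW
  have hWlow : η / 2 * 𝒜.card < W := by
    have h1 : NN m n * ∑ X, fhat f X ^ 2 * ((1 / 2 ^ X.rank) * N1)
        ≤ NN m n * ∑ X, (g X ^ 2 + (1/2) ^ d * fhat f X ^ 2) * N1 :=
      mul_le_mul_of_nonneg_left (Finset.sum_le_sum fun X _ => hpt X) NN_pos.le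
    rw [← Finset.sum_mul, Finset.sum_add_distrib, ← Finset.mul_sum] at h1
    have h2 : NN m n * ((∑ X, g X ^ 2 + (1/2) ^ d * ∑ X, fhat f X ^ 2) * N1)
        = (W + (1/2) ^ d * 𝒜.card) * N1 := by
      rw [← pars, hW]; ring
    have h3 : η * 𝒜.card * N1 ≤ (W + (1/2) ^ d * 𝒜.card) * N1 := by linarith
    have h4 := le_of_mul_le_mul_right h3 hN1pos
    nlinarith
  have hlev := level s s0.le s1 d m n f f0 f1 hPR g (fun X hX => by
    by_contra hc; exact hX (by simp [hg, hc]))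
  rw [sum_GG_sq, ← hW] at hlev
  have hfG : ∑ A, f A * (f A * GG g A) = W := by
    have : ∑ A, f A * (f A * GG g A) = ∑ A, GG (fhat f) A * GG g A := by
      refine Finset.sum_congr rfl fun A _ => ?_
      rw [← mul_assoc, ← sq, ff, inversion]
    rw [this, parseval, hW]
    congr 1
    refine Finset.sum_congr rfl fun X _ => ?_
    simp only [hg]; split_ifs <;> ring
  have hcs := Finset.sum_mul_sq_le_sq_mul_sq Finset.univ f (fun A => f A * GG g A)
  rw [hfG] at hcs
  simp only [mul_pow, ff, hμ] at hcs
  have hWpos : 0 < W := by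
    have : 0 < η / 2 * 𝒜.card := by positivity
    linarith
  have h5 : W ^ 2 ≤ 𝒜.card * (cc d * s * W) :=
    hcs.trans (mul_le_mul_of_nonneg_left hlev hμpos.le)
  have h6 : W ≤ 𝒜.card * (cc d * s) := by
    refine le_of_mul_le_mul_right ?_ hWpos
    nlinarith
  nlinarith

end KMS

theorem stmt0 (η : ℝ) (hη : 0 < η) :
    ∃ δ : ℝ, 0 < δ ∧ ∃ k : ℕ, 0 < k ∧
      ∀ m n : ℕ, 0 < m → 0 < n →
        ∀ A : Finset (Matrix (Fin m) (Fin n) (ZMod 2)), A.Nonempty →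
          (η * A.card * (((2:ℝ) ^ m - 1) * ((2:ℝ) ^ n - 1)) ≤ (closedPairs m n A : ℝ)) →
          ∃ C : Finset (Matrix (Fin m) (Fin n) (ZMod 2)),
            C.Nonempty ∧
            (∃ L : List (Finset (Matrix (Fin m) (Fin n) (ZMod 2))),
              L.length ≤ k ∧ (∀ S ∈ L, IsBasic m n S) ∧
              C = L.foldr (· ∩ ·) Finset.univ) ∧
            δ * C.card ≤ ((A ∩ C).card : ℝ) := by
  exact KMS.main η hη
end

section
/- For every positive integer d and every θ > 0 there exists ε > 0 such that for every δ > 0 there exists a positive integer k with the following property: for all positive integers n_1,…,n_d, every submultiset ℬ' ⊆ ℬ with |ℬ'| ≥ δ|ℬ|, and every nonempty subset 𝒜 ⊆ 𝒢 that is (ℬ',1−ε)-closed, there exists a k-simple set 𝒟 ⊆ 𝒢 such that |𝒟 ∩ 𝒜| ≥ (1−θ)|𝒟|. -/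
open Finset

/-- The space of `d`-tuples `(u_1, …, u_d)` with `u_i ∈ F_2^{n_i}`. -/
abbrev Tup (d : ℕ) (n : Fin d → ℕ) := (i : Fin d) → (Fin (n i) → ZMod 2)

/-- `𝒢 = F_2^{n_1} ⊗ ⋯ ⊗ F_2^{n_d}`, realized as `d`-dimensional arrays. -/
abbrev Arr (d : ℕ) (n : Fin d → ℕ) := ((i : Fin d) → Fin (n i)) → ZMod 2

/-- The rank-one tensor `u_1 ⊗ ⋯ ⊗ u_d`. -/
def tensorOf (d : ℕ) (n : Fin d → ℕ) (u : Tup d n) : Arr d n :=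
  fun x => ∏ i, u i (x i)

/-- `F_2^I = ⊗_{i ∈ I} F_2^{n_i}`, realized as arrays indexed by coordinates in `I`. -/
abbrev F2I (d : ℕ) (n : Fin d → ℕ) (I : Finset (Fin d)) :=
  ((i : {x : Fin d // x ∈ I}) → Fin (n i.1)) → ZMod 2

/-- The `I`-arrSlice of an array `r`, obtained by fixing the coordinates outside `I` to be `z`. -/
def arrSlice (d : ℕ) (n : Fin d → ℕ) (I : Finset (Fin d)) (r : Arr d n)
    (z : (i : {x : Fin d // x ∉ I}) → Fin (n i.1)) : F2I d n I :=
  fun y => r (fun i => if h : i ∈ I then y ⟨i, h⟩ else z ⟨i, h⟩)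

/-- The subspace `H ⊗ F_2^{I^c}` of `𝒢`: arrays all of whose `I`-slices lie in `H`. -/
def cylSub (d : ℕ) (n : Fin d → ℕ) (I : Finset (Fin d))
    (H : Submodule (ZMod 2) (F2I d n I)) : Submodule (ZMod 2) (Arr d n) where
  carrier := {r | ∀ z, arrSlice d n I r z ∈ H}
  add_mem' := fun ha hb z => H.add_mem (ha z) (hb z)
  zero_mem' := fun z => H.zero_mem
  smul_mem' := fun c _ hr z => H.smul_mem c (hr z)

/-- A subset of `𝒢` is `k`-simple if it is a translate of `⋂_{∅ ≠ I ⊆ [d]} (H_I ⊗ F_2^{I^c})`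
for subspaces `H_I ⊆ F_2^I` of codimension at most `k`. -/
def IsKSimple (d : ℕ) (n : Fin d → ℕ) (k : ℕ) (D : Set (Arr d n)) : Prop :=
  ∃ t : Arr d n, ∃ H : (I : Finset (Fin d)) → Submodule (ZMod 2) (F2I d n I),
    (∀ I : Finset (Fin d), I.Nonempty →
      Module.finrank (ZMod 2) (F2I d n I) - Module.finrank (ZMod 2) (H I) ≤ k) ∧
    D = {x | ∃ r : Arr d n,
      (∀ I : Finset (Fin d), I.Nonempty → r ∈ cylSub d n I (H I)) ∧ x = t + r}

/-- The number of pairs `(a, u) ∈ 𝒜 × ℬ'` with `a + u_1 ⊗ ⋯ ⊗ u_d ∈ 𝒜`. -/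
def closedCnt (d : ℕ) (n : Fin d → ℕ) (A : Finset (Arr d n)) (B' : Finset (Tup d n)) : ℕ :=
  ((A ×ˢ B').filter (fun p => p.1 + tensorOf d n p.2 ∈ A)).card

section basics

noncomputable def av {α : Type*} [Fintype α] (f : α → ℝ) : ℝ := (∑ u, f u) / (Fintype.card α : ℝ)

section avl
variable {α : Type*} [Fintype α]

lemma av_add (f g : α → ℝ) : av (fun u => f u + g u) = av f + av g := by
  simp [av, Finset.sum_add_distrib, add_div]

lemma av_sub (f g : α → ℝ) : av (fun u => f u - g u) = av f - av g := by
  simp [av, Finset.sum_sub_distrib, sub_div]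

lemma av_mul (c : ℝ) (f : α → ℝ) : av (fun u => c * f u) = c * av f := by
  simp [av, ← Finset.mul_sum, mul_div_assoc]

lemma av_mul' (c : ℝ) (f : α → ℝ) : av (fun u => f u * c) = av f * c := by
  simp_rw [mul_comm _ c]; exact av_mul c f

lemma av_mono {f g : α → ℝ} (h : ∀ u, f u ≤ g u) : av f ≤ av g := by
  unfold av
  gcongr with u
  exact h u

lemma av_nonneg {f : α → ℝ} (h : ∀ u, 0 ≤ f u) : 0 ≤ av f := by
  unfold av
  exact div_nonneg (Finset.sum_nonneg fun u _ => h u) (Nat.cast_nonneg _)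

lemma av_const [Nonempty α] (c : ℝ) : av (fun _ : α => c) = c := by
  have : (Fintype.card α : ℝ) ≠ 0 := by exact_mod_cast Fintype.card_ne_zero
  simp [av, this]

lemma av_sum {κ : Type*} (s : Finset κ) (f : κ → α → ℝ) :
    av (fun u => ∑ k ∈ s, f k u) = ∑ k ∈ s, av (f k) := by
  unfold av
  rw [Finset.sum_comm, Finset.sum_div]

lemma av_comm {β : Type*} [Fintype β] (f : α → β → ℝ) :
    av (fun u => av (fun v => f u v)) = av (fun v => av (fun u => f u v)) := by
  unfold av
  simp_rw [← Finset.sum_div]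
  rw [Finset.sum_comm]
  rw [div_div, div_div, mul_comm]

/-- pigeonhole -/
lemma av_exists_le [Nonempty α] {f : α → ℝ} (h : 0 ≤ av f) : ∃ u, 0 ≤ f u := by
  by_contra hc
  push Not at hc
  have : (0 : ℝ) < Fintype.card α := by exact_mod_cast Fintype.card_pos
  have h2 : ∑ u, f u < 0 := Finset.sum_neg (fun u _ => hc u) Finset.univ_nonempty
  have := div_neg_of_neg_of_pos h2 this
  unfold av at h
  linarith

lemma av_equiv {β : Type*} [Fintype β] (e : α ≃ β) (f : β → ℝ) :
    av (fun u => f (e u)) = av f := by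
  unfold av
  rw [Fintype.card_congr e, Equiv.sum_comp e f]

lemma av_cs (f g : α → ℝ) : (av (fun u => f u * g u)) ^ 2 ≤ av (fun u => f u ^ 2) * av (fun u => g u ^ 2) := by
  unfold av
  rw [div_pow, div_mul_div_comm, ← sq]
  gcongr
  exact Finset.sum_mul_sq_le_sq_mul_sq _ _ _

end avl

noncomputable def ind (p : Prop) : ℝ := by classical exact if p then 1 else 0

lemma ind_nonneg (p : Prop) : 0 ≤ ind p := by unfold ind; split <;> norm_num
lemma ind_le_one (p : Prop) : ind p ≤ 1 := by unfold ind; split <;> norm_num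
lemma ind_true {p : Prop} (h : p) : ind p = 1 := by simp [ind, h]
lemma ind_false {p : Prop} (h : ¬ p) : ind p = 0 := by simp [ind, h]
lemma ind_mono {p q : Prop} (h : p → q) : ind p ≤ ind q := by
  by_cases hp : p
  · rw [ind_true hp, ind_true (h hp)]
  · rw [ind_false hp]; exact ind_nonneg _

def sg (x : ZMod 2) : ℝ := if x = 0 then 1 else -1

lemma zcases (x : ZMod 2) : x = 0 ∨ x = 1 := by revert x; decide

lemma sg_add (x y : ZMod 2) : sg (x + y) = sg x * sg y := by
  have h2 : (1 + 1 : ZMod 2) = 0 := by decide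
  rcases zcases x with rfl | rfl <;> rcases zcases y with rfl | rfl <;> simp [sg, h2]

lemma sg_ind (x : ZMod 2) : sg x = 1 - 2 * ind (x ≠ 0) := by
  unfold sg ind; split <;> simp_all <;> norm_num

lemma sg_zero : sg 0 = 1 := by simp [sg]

lemma sg_one : sg 1 = -1 := by simp [sg]

lemma sg_sum {κ : Type*} (s : Finset κ) (f : κ → ZMod 2) : sg (∑ i ∈ s, f i) = ∏ i ∈ s, sg (f i) := by
  classical
  induction s using Finset.induction_on with
  | empty => simp [sg_zero]
  | insert a s ha ih => rw [Finset.sum_insert ha, Finset.prod_insert ha, sg_add, ih]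

lemma self_add {G : Type*} [AddCommGroup G] [Module (ZMod 2) G] (x : G) : x + x = 0 := by
  have : ((1 : ZMod 2) + 1) • x = 0 := by
    rw [show (1 + 1 : ZMod 2) = 0 by decide, zero_smul]
  rwa [add_smul, one_smul] at this

lemma av_sg_of_additive {G : Type*} [AddCommGroup G] [Fintype G] (f : G → ZMod 2)
    (hf : ∀ x y, f (x + y) = f x + f y) : av (fun x => sg (f x)) = ind (∀ x, f x = 0) := by
  classical
  by_cases h : ∀ x, f x = 0
  · rw [ind_true h]; simp_rw [h, sg_zero]; exact av_const 1
  · rw [ind_false h]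
    push Not at h
    obtain ⟨y, hy⟩ := h
    have h1 : av (fun x => sg (f (x + y))) = av (fun x => sg (f x)) :=
      av_equiv (Equiv.addRight y) (fun x => sg (f x))
    have h2 : ∀ x, sg (f (x + y)) = -1 * sg (f x) := by
      intro x
      rw [hf, sg_add, (zcases (f y)).resolve_left hy, sg_one]; ring
    simp_rw [h2] at h1
    rw [av_mul] at h1
    linarith

end basics

section ml
variable {d : ℕ} {n : Fin d → ℕ}

abbrev Fn (d : ℕ) (n : Fin d → ℕ) := Tup d n → ZMod 2

/-- Multilinear in the coordinates of `I`, independent of the others. -/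
def ML (d : ℕ) (n : Fin d → ℕ) (I : Finset (Fin d)) : Submodule (ZMod 2) (Fn d n) where
  carrier := {f | (∀ i ∈ I, ∀ u x y, f (Function.update u i (x + y)) =
      f (Function.update u i x) + f (Function.update u i y)) ∧
      ∀ i ∉ I, ∀ u x, f (Function.update u i x) = f u}
  add_mem' := by
    rintro f g ⟨hf, hf'⟩ ⟨hg, hg'⟩
    refine ⟨fun i hi u x y => ?_, fun i hi u x => ?_⟩
    · simp only [Pi.add_apply, hf i hi, hg i hi]; ring
    · simp only [Pi.add_apply, hf' i hi, hg' i hi]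
  zero_mem' := by refine ⟨fun i hi u x y => ?_, fun i hi u x => ?_⟩ <;> simp
  smul_mem' := by
    rintro c f ⟨hf, hf'⟩
    refine ⟨fun i hi u x y => ?_, fun i hi u x => ?_⟩
    · simp only [Pi.smul_apply, hf i hi, smul_add]
    · simp only [Pi.smul_apply, hf' i hi]

lemma ML_lin {I : Finset (Fin d)} {f : Fn d n} (hf : f ∈ ML d n I) {i} (hi : i ∈ I) (u x y) :
    f (Function.update u i (x + y)) = f (Function.update u i x) + f (Function.update u i y) :=
  hf.1 i hi u x y

lemma ML_ind {I : Finset (Fin d)} {f : Fn d n} (hf : f ∈ ML d n I) {i} (hi : i ∉ I) (u x) :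
    f (Function.update u i x) = f u := hf.2 i hi u x

lemma ML_mul {I J : Finset (Fin d)} (h : Disjoint I J) {f g : Fn d n} (hf : f ∈ ML d n I)
    (hg : g ∈ ML d n J) : f * g ∈ ML d n (I ∪ J) := by
  refine ⟨fun i hi u x y => ?_, fun i hi u x => ?_⟩
  · simp only [Pi.mul_apply]
    rcases Finset.mem_union.1 hi with hi | hi
    · have : i ∉ J := Finset.disjoint_left.1 h hi
      simp only [ML_lin hf hi, ML_ind hg this]; ring
    · have : i ∉ I := Finset.disjoint_right.1 h hi
      simp only [ML_lin hg hi, ML_ind hf this]; ring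
  · simp only [Finset.mem_union, not_or] at hi
    simp only [Pi.mul_apply, ML_ind hf hi.1, ML_ind hg hi.2]

lemma ML_mul' {I J K : Finset (Fin d)} (h : Disjoint I J) (hK : I ∪ J = K) {f g : Fn d n}
    (hf : f ∈ ML d n I) (hg : g ∈ ML d n J) : f * g ∈ ML d n K := hK ▸ ML_mul h hf hg

lemma ML_pw_eq {I : Finset (Fin d)} {f : Fn d n} (hf : f ∈ ML d n I) (u v : Tup d n)
    (s : Finset (Fin d)) (hs : Disjoint s I) : f (s.piecewise v u) = f u := by
  induction s using Finset.induction_on with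
  | empty => simp
  | insert a s ha ih =>
    rw [Finset.disjoint_insert_left] at hs
    rw [Finset.piecewise_insert, ML_ind hf hs.1, ih hs.2]

lemma ML_pw_eq' {I : Finset (Fin d)} {f : Fn d n} (hf : f ∈ ML d n I) (u v : Tup d n)
    (s : Finset (Fin d)) (hs : I ⊆ s) : f (s.piecewise v u) = f v := by
  rw [← Finset.piecewise_compl]
  exact ML_pw_eq hf v u _ (Finset.disjoint_left.2 fun i hi hi' => by
    rw [Finset.mem_compl] at hi; exact hi (hs hi'))

lemma ML_contract {I : Finset (Fin d)} {f : Fn d n} (hf : f ∈ ML d n I) (u : Tup d n)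
    (P : Finset (Fin d)) : (fun x => f (P.piecewise x u)) ∈ ML d n (P ∩ I) := by
  have h1 : ∀ i ∈ P, ∀ (x : Tup d n) y, P.piecewise (Function.update x i y) u
      = Function.update (P.piecewise x u) i y := by
    intro i hi x y
    ext1 j
    by_cases hj : j = i
    · subst hj; simp [hi]
    · simp only [Function.update_of_ne hj, Finset.piecewise]
  have h2 : ∀ i ∉ P, ∀ (x : Tup d n) y, P.piecewise (Function.update x i y) u
      = P.piecewise x u := by
    intro i hi x y
    ext1 j
    by_cases hj : j = i
    · subst hj; simp [hi]
    · simp only [Function.update_of_ne hj, Finset.piecewise]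
  refine ⟨fun i hi v x y => ?_, fun i hi v x => ?_⟩
  · rw [Finset.mem_inter] at hi
    simp only [h1 i hi.1, ML_lin hf hi.2]
  · by_cases hP : i ∈ P
    · have : i ∉ I := fun h => hi (Finset.mem_inter.2 ⟨hP, h⟩)
      simp only [h1 i hP, ML_ind hf this]
    · simp only [h2 i hP]

/-- averaging over a block of coordinates -/
lemma av_pw (P : Finset (Fin d)) (F : Tup d n → ℝ) :
    av (fun u => av (fun x => F (P.piecewise x u))) = av F := by
  let e : Tup d n × Tup d n ≃ Tup d n × Tup d n :=
    { toFun := fun p => (P.piecewise p.1 p.2, P.piecewise p.2 p.1)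
      invFun := fun p => (P.piecewise p.1 p.2, P.piecewise p.2 p.1)
      left_inv := by
        rintro ⟨a, b⟩
        ext i : 2 <;> by_cases hi : i ∈ P <;> simp [hi]
      right_inv := by
        rintro ⟨a, b⟩
        ext i : 2 <;> by_cases hi : i ∈ P <;> simp [hi] }
  have h := Equiv.sum_comp e (fun p => F p.1)
  rw [Fintype.sum_prod_type, Fintype.sum_prod_type] at h
  have hc : (Fintype.card (Tup d n) : ℝ) ≠ 0 := by exact_mod_cast Fintype.card_ne_zero
  unfold av
  simp_rw [← Finset.sum_div]
  rw [Finset.sum_comm, div_div]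
  simp only [e, Equiv.coe_fn_mk] at h
  rw [h]
  simp only [Finset.sum_const, Finset.card_univ, nsmul_eq_mul]
  rw [← Finset.mul_sum]
  field_simp

/-- structured functions -/
def Str (J : Finset (Fin d)) (S : Finset (Finset (Fin d) × Fn d n)) : Submodule (ZMod 2) (Fn d n) :=
  Submodule.span (ZMod 2) {f | ∃ p ∈ S, p.1.Nonempty ∧ p.1 ⊆ J ∧ p.2 ∈ ML d n p.1 ∧
    ∃ z ∈ ML d n (J \ p.1), f = p.2 * z}

lemma Str_mono {J : Finset (Fin d)} {S S' : Finset (Finset (Fin d) × Fn d n)} (h : S ⊆ S') :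
    Str J S ≤ Str J S' := by
  apply Submodule.span_mono
  rintro f ⟨p, hp, h1⟩
  exact ⟨p, h hp, h1⟩

lemma Str_mul {K P J : Finset (Fin d)} {S : Finset (Finset (Fin d) × Fn d n)} (hKP : Disjoint P K)
    (hJ : P ∪ K = J) {q f : Fn d n} (hq : q ∈ ML d n P) (hf : f ∈ Str K S) : q * f ∈ Str J S := by
  unfold Str at hf
  induction hf using Submodule.span_induction with
  | mem x hx =>
    obtain ⟨p, hp, h1, h2, h3, z, hz, rfl⟩ := hx
    apply Submodule.subset_span
    refine ⟨p, hp, h1, ?_, h3, q * z, ?_, by ring⟩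
    · rw [← hJ]; exact h2.trans Finset.subset_union_right
    · refine ML_mul' (hKP.mono_right Finset.sdiff_subset) ?_ hq hz
      rw [← hJ, Finset.union_sdiff_distrib]
      congr 1
      exact (Finset.sdiff_eq_self_of_disjoint (hKP.mono_right h2)).symm
  | zero => simp
  | add x y _ _ hx hy => rw [mul_add]; exact add_mem hx hy
  | smul a x _ hx => rw [mul_smul_comm]; exact Submodule.smul_mem _ _ hx

lemma Str_explicit {J : Finset (Fin d)} {S : Finset (Finset (Fin d) × Fn d n)} {f : Fn d n}
    (hf : f ∈ Str J S) : ∃ T ⊆ S, ∃ z : Finset (Fin d) × Fn d n → Fn d n,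
      (∀ p ∈ T, p.1.Nonempty ∧ p.1 ⊆ J ∧ p.2 ∈ ML d n p.1 ∧ z p ∈ ML d n (J \ p.1)) ∧
      f = ∑ p ∈ T, p.2 * z p := by
  classical
  refine ⟨S.filter (fun p => p.1.Nonempty ∧ p.1 ⊆ J ∧ p.2 ∈ ML d n p.1),
    Finset.filter_subset _ _, ?_⟩
  suffices h : ∃ z : Finset (Fin d) × Fn d n → Fn d n, (∀ p, z p ∈ ML d n (J \ p.1)) ∧
      f = ∑ p ∈ S.filter (fun p => p.1.Nonempty ∧ p.1 ⊆ J ∧ p.2 ∈ ML d n p.1), p.2 * z p by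
    obtain ⟨z, hz, h⟩ := h
    refine ⟨z, fun p hp => ?_, h⟩
    rw [Finset.mem_filter] at hp
    exact ⟨hp.2.1, hp.2.2.1, hp.2.2.2, hz p⟩
  unfold Str at hf
  induction hf using Submodule.span_induction with
  | mem x hx =>
    obtain ⟨p, hp, h1, h2, h3, z, hz, rfl⟩ := hx
    refine ⟨fun q => if q = p then z else 0, fun q => ?_, ?_⟩
    · dsimp only
      split
      · rename_i h; rw [h]; exact hz
      · exact zero_mem _
    · rw [Finset.sum_eq_single p]
      · simp
      · intro b _ hb; simp [hb]
      · intro h; exact absurd (Finset.mem_filter.2 ⟨hp, h1, h2, h3⟩) h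
  | zero => exact ⟨0, fun q => zero_mem _, by simp⟩
  | add x y _ _ hx hy =>
    obtain ⟨z, hz, rfl⟩ := hx
    obtain ⟨z', hz', rfl⟩ := hy
    refine ⟨z + z', fun p => add_mem (hz p) (hz' p), ?_⟩
    simp [mul_add, Finset.sum_add_distrib]
  | smul a x _ hx =>
    obtain ⟨z, hz, rfl⟩ := hx
    refine ⟨a • z, fun p => Submodule.smul_mem _ _ (hz p), ?_⟩
    rw [Finset.smul_sum]
    simp

/-- sums of at most `C` products along splits `Q | J \ Q` with `Q` allowed -/
inductive LR (Qs : Finset (Fin d) → Prop) (J : Finset (Fin d)) : ℕ → Fn d n → Prop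
  | zero (C : ℕ) : LR Qs J C 0
  | add {C : ℕ} {r : Fn d n} {Q : Finset (Fin d)} {a y : Fn d n} (h : Qs Q) (h' : Q ⊆ J)
      (ha : a ∈ ML d n Q) (hy : y ∈ ML d n (J \ Q)) (hr : LR Qs J C r) : LR Qs J (C + 1) (r + a * y)

variable {Qs Qs' : Finset (Fin d) → Prop} {J P : Finset (Fin d)}

lemma LR_mono {C C' : ℕ} (h : C ≤ C') (hQ : ∀ Q, Q ⊆ J → Qs Q → Qs' Q) {r : Fn d n}
    (hr : LR Qs J C r) : LR Qs' J C' r := by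
  induction hr generalizing C' with
  | zero C => exact LR.zero _
  | add h1 h2 ha hy _ ih =>
    obtain ⟨C'', rfl⟩ : ∃ C'', C' = C'' + 1 := ⟨C' - 1, by omega⟩
    exact LR.add (hQ _ h2 h1) h2 ha hy (ih (by omega))

lemma LR_add {C C' : ℕ} {r r' : Fn d n} (hr : LR Qs J C r) (hr' : LR Qs J C' r') :
    LR Qs J (C + C') (r + r') := by
  induction hr' with
  | zero C' => rw [add_zero]; exact LR_mono (by omega) (fun _ _ h => h) hr
  | add h1 h2 ha hy _ ih =>
    rw [← add_assoc, ← add_assoc]; exact LR.add h1 h2 ha hy ih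

lemma LR_one {Q : Finset (Fin d)} {a y : Fn d n} (h : Qs Q) (h' : Q ⊆ J)
      (ha : a ∈ ML d n Q) (hy : y ∈ ML d n (J \ Q)) : LR Qs J 1 (a * y) := by
  have := LR.add h h' ha hy (LR.zero 0)
  simpa using this

lemma LR_sum {κ : Type*} (s : Finset κ) (C : ℕ) (f : κ → Fn d n) (h : ∀ k ∈ s, LR Qs J C (f k)) :
    LR Qs J (s.card * C) (∑ k ∈ s, f k) := by
  classical
  induction s using Finset.induction_on with
  | empty => simp; exact LR.zero _
  | insert a s ha ih =>
    rw [Finset.sum_insert ha, Finset.card_insert_of_notMem ha, add_mul, one_mul, add_comm (s.card * C)]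
    exact LR_add (h a (Finset.mem_insert_self _ _)) (ih fun k hk => h k (Finset.mem_insert_of_mem hk))

lemma LR_ML {C : ℕ} {r : Fn d n} (hr : LR Qs J C r) : r ∈ ML d n J := by
  induction hr with
  | zero => exact zero_mem _
  | add h1 h2 ha hy _ ih =>
    exact add_mem ih (ML_mul' Finset.disjoint_sdiff (Finset.union_sdiff_of_subset h2) ha hy)

lemma LR_split {C : ℕ} {r : Fn d n} (hr : LR (fun Q => Qs Q ∨ Q = P) J C r) :
    ∃ a y : Fin C → Fn d n, (∀ i, a i ∈ ML d n P) ∧ (∀ i, y i ∈ ML d n (J \ P)) ∧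
      ∃ r', LR Qs J C r' ∧ r = ∑ i, a i * y i + r' := by
  induction hr with
  | zero C => exact ⟨0, 0, fun i => zero_mem _, fun i => zero_mem _, 0, LR.zero _, by simp⟩
  | @add C r Q a y h1 h2 ha hy _ ih =>
    obtain ⟨A, Y, hA, hY, r', hr', rfl⟩ := ih
    rcases h1 with h1 | rfl
    · refine ⟨Fin.cons 0 A, Fin.cons 0 Y, fun i => ?_, fun i => ?_, r' + a * y,
        LR.add h1 h2 ha hy hr', ?_⟩
      · refine Fin.cases ?_ (fun i => ?_) i
        · exact zero_mem _
        · exact hA i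
      · refine Fin.cases ?_ (fun i => ?_) i
        · exact zero_mem _
        · exact hY i
      · rw [Fin.sum_univ_succ]; simp [add_assoc]
    · refine ⟨Fin.cons a A, Fin.cons y Y, fun i => ?_, fun i => ?_, r',
        LR_mono (by omega) (fun _ _ h => h) hr', ?_⟩
      · refine Fin.cases ?_ (fun i => ?_) i
        · exact ha
        · exact hA i
      · refine Fin.cases ?_ (fun i => ?_) i
        · exact hy
        · exact hY i
      · rw [Fin.sum_univ_succ]; simp; ring

lemma LR_contract {j : Fin d} {C : ℕ} {r : Fn d n} (hPJ : P ⊆ J) (hj : j ∈ P)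
    (hQ : ∀ Q, Qs Q → j ∈ Q ∧ ¬ P ⊆ Q)
    (hr : LR Qs J C r) (u : Tup d n) :
    LR (fun Q => j ∈ Q ∧ Q ≠ P) P C (fun x => r (P.piecewise x u)) := by
  induction hr with
  | zero C => exact LR.zero _
  | @add C r Q a y h1 h2 ha hy _ ih =>
    have h3 := hQ Q h1
    refine LR.add (Q := P ∩ Q) ⟨Finset.mem_inter.2 ⟨hj, h3.1⟩, fun h => h3.2 ?_⟩
      Finset.inter_subset_left (ML_contract ha u P) ?_ ih
    · rw [← h]; exact Finset.inter_subset_right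
    · have := ML_contract hy u P
      convert this using 2
      ext i; simp only [Finset.mem_sdiff, Finset.mem_inter]
      constructor
      · rintro ⟨h, h'⟩; exact ⟨h, hPJ h, fun h'' => h' ⟨h, h''⟩⟩
      · rintro ⟨h, _, h'⟩; exact ⟨h, fun h'' => h' h''.2⟩

lemma LR_mulr {C : ℕ} {f y : Fn d n} (hPJ : P ⊆ J) (hf : LR Qs P C f) (hy : y ∈ ML d n (J \ P)) :
    LR Qs J C (f * y) := by
  induction hf with
  | zero C => rw [zero_mul]; exact LR.zero _
  | @add C r Q a b h1 h2 ha hb _ ih =>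
    rw [add_mul, mul_assoc]
    refine LR.add h1 (h2.trans hPJ) ha (ML_mul' ?_ ?_ hb hy) ih
    · exact Finset.disjoint_left.2 fun i hi hi' =>
        (Finset.mem_sdiff.1 hi').2 (Finset.mem_sdiff.1 hi).1
    · ext i; simp only [Finset.mem_union, Finset.mem_sdiff]
      constructor
      · rintro (⟨h, h'⟩ | ⟨h, h'⟩)
        · exact ⟨hPJ h, h'⟩
        · exact ⟨h, fun h'' => h' (h2 h'')⟩
      · rintro ⟨h, h'⟩
        by_cases hp : i ∈ P
        · exact Or.inl ⟨hp, h'⟩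
        · exact Or.inr ⟨h, hp⟩

lemma Str_LR {j : Fin d} {S : Finset (Finset (Fin d) × Fn d n)} {f : Fn d n} (hj : j ∈ P)
    (hS : ∀ p ∈ S, j ∉ p.1) (hf : f ∈ Str P S) : LR (fun Q => j ∈ Q ∧ Q ≠ P) P S.card f := by
  obtain ⟨T, hT, z, hz, rfl⟩ := Str_explicit hf
  have : LR (fun Q => j ∈ Q ∧ Q ≠ P) P (T.card * 1) (∑ p ∈ T, p.2 * z p) := by
    apply LR_sum
    intro p hp
    obtain ⟨h1, h2, h3, h4⟩ := hz p hp
    rw [mul_comm]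
    refine LR_one (Q := P \ p.1) ⟨Finset.mem_sdiff.2 ⟨hj, hS p (hT hp)⟩, fun h => ?_⟩
      Finset.sdiff_subset h4 ?_
    · obtain ⟨i, hi⟩ := h1
      have : i ∈ P \ p.1 := by rw [h]; exact h2 hi
      exact (Finset.mem_sdiff.1 this).2 hi
    · rwa [Finset.sdiff_sdiff_eq_self h2]
  refine LR_mono ?_ (fun _ _ h => h) this
  simpa using Finset.card_le_card hT

end ml
section bp

/-- the main inductive property -/
def PP (d : ℕ) (J : Finset (Fin d)) : Prop :=
  ∃ η : ℝ, 0 < η ∧ ∀ δ : ℝ, 0 < δ → ∃ k : ℕ, ∀ (n : Fin d → ℕ) (g : Tup d n → ℝ),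
    (∀ u, 0 ≤ g u) → (∀ u, g u ≤ 1) → δ ≤ av g →
    ∃ S : Finset (Finset (Fin d) × Fn d n), S.card ≤ k ∧ ∀ r ∈ ML d n J,
      av (fun u => g u * ind (r u ≠ 0)) ≤ η * av g → r ∈ Str J S

variable {d : ℕ}

lemma pw_singleton {n : Fin d → ℕ} (j : Fin d) (x u : Tup d n) :
    ({j} : Finset (Fin d)).piecewise x u = Function.update u j (x j) := by
  rw [Finset.piecewise_singleton]

/-- additive maps on one coordinate are determined by the basis -/
lemma ML_expand {n : Fin d → ℕ} {I : Finset (Fin d)} {f : Fn d n} (hf : f ∈ ML d n I) {j : Fin d}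
    (hj : j ∈ I) (u : Tup d n) (x : Fin (n j) → ZMod 2) :
    f (Function.update u j x) = ∑ k, x k * f (Function.update u j (Pi.single k 1)) := by
  let L : (Fin (n j) → ZMod 2) →+ ZMod 2 := AddMonoidHom.mk' (fun x => f (Function.update u j x))
    (fun x y => ML_lin hf hj u x y)
  let L' : (Fin (n j) → ZMod 2) →ₗ[ZMod 2] ZMod 2 := L.toZModLinearMap 2
  have h : L' x = ∑ k, x k • L' (Pi.single k 1) := by
    conv_lhs => rw [pi_eq_sum_univ' x]
    rw [map_sum]
    simp_rw [map_smul]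
  simpa [L', L] using h

lemma coord_ML {n : Fin d → ℕ} (j : Fin d) (k : Fin (n j)) : (fun u => u j k : Fn d n) ∈ ML d n {j} := by
  refine ⟨fun i hi u x y => ?_, fun i hi u x => ?_⟩
  · rw [Finset.mem_singleton] at hi; subst hi; simp
  · rw [Finset.mem_singleton] at hi
    simp [Function.update_of_ne (Ne.symm hi)]

lemma BP {P : Finset (Fin d)} {j : Fin d} (hj : j ∈ P) (hP : PP d (P.erase j)) (c : ℝ) (hc : 0 < c) :
    ∃ C : ℕ, ∀ (n : Fin d → ℕ) (a : Fn d n), a ∈ ML d n P → c ≤ av (fun u => sg (a u)) →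
      LR (fun Q => j ∈ Q ∧ Q ≠ P) P C a := by
  classical
  obtain ⟨η, hη, H⟩ := hP
  obtain ⟨k, H⟩ := H c hc
  refine ⟨k, fun n a ha hca => ?_⟩
  set g : Tup d n → ℝ := fun u => ind (∀ x, a (Function.update u j x) = 0) with hg
  have hga : av (fun u => sg (a u)) = av g := by
    rw [← av_pw {j} (fun u => sg (a u))]
    congr 1; ext u
    simp_rw [pw_singleton]
    have h1 := av_sg_of_additive (fun x : Tup d n => a (Function.update u j (x j)))
      (fun x y => by simp only [Pi.add_apply]; exact ML_lin ha hj u _ _)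
    rw [h1, hg]
    dsimp only
    congr 1
    apply propext
    constructor
    · intro h x
      have := h (Function.update u j x)
      simpa using this
    · intro h x; exact h _
  obtain ⟨S, hS, hH⟩ := H n g (fun u => ind_nonneg _) (fun u => ind_le_one _) (by rw [← hga]; exact hca)
  have hx : ∀ x, (fun u => a (Function.update u j x)) ∈ Str (P.erase j) S := by
    intro x
    apply hH
    · have h1 := ML_contract ha (fun i => if h : i = j then h ▸ x else 0) (P.erase j)
      refine ⟨fun i hi u y z => ?_, fun i hi u y => ?_⟩
      · have hij : i ≠ j := Finset.ne_of_mem_erase hi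
        simp only [Function.update_comm hij]
        exact ML_lin ha (Finset.mem_of_mem_erase hi) _ _ _
      · by_cases hij : i = j
        · subst hij; simp
        · simp only [Function.update_comm hij]
          exact ML_ind ha (fun h => hi (Finset.mem_erase.2 ⟨hij, h⟩)) _ _
    · have : av (fun u => g u * ind (a (Function.update u j x) ≠ 0)) = 0 := by
        have h0 : ∀ u, g u * ind (a (Function.update u j x) ≠ 0) = 0 := by
          intro u
          by_cases h : ∀ x, a (Function.update u j x) = 0
          · rw [ind_false (not_not.2 (h x)), mul_zero]
          · simp only [hg]; rw [ind_false h, zero_mul]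
        simp_rw [h0]; exact av_const 0
      rw [this]
      exact mul_nonneg hη.le (av_nonneg fun u => ind_nonneg _)
  set S' := S.filter (fun p => j ∉ p.1) with hS'
  have hsub : Str (P.erase j) S ≤ Str (P.erase j) S' := by
    apply Submodule.span_mono
    rintro f ⟨p, hp, h1, h2, h3⟩
    refine ⟨p, Finset.mem_filter.2 ⟨hp, fun h => ?_⟩, h1, h2, h3⟩
    exact Finset.notMem_erase _ _ (h2 h)
  have haS : a ∈ Str P S' := by
    have h1 : a = ∑ k, (fun u => u j k : Fn d n) * (fun u => a (Function.update u j (Pi.single k 1))) := by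
      ext u
      have := ML_expand ha hj u (u j)
      rw [Function.update_eq_self] at this
      simpa using this
    rw [h1]
    apply Submodule.sum_mem
    intro k _
    refine Str_mul (K := P.erase j) (P := {j}) ?_ ?_ (coord_ML j k) (hsub (hx _))
    · simp
    · rw [← Finset.insert_eq, Finset.insert_erase hj]
  refine LR_mono ?_ (fun _ _ h => h) (Str_LR hj (fun p hp => (Finset.mem_filter.1 hp).2) haS)
  exact (Finset.card_filter_le _ _).trans hS

end bp
section stepA
variable {d : ℕ} {n : Fin d → ℕ}

lemma cs_bound {α κ : Type*} [Fintype α] [Nonempty α] [DecidableEq κ] (T : Finset κ) (b : κ → α → ZMod 2)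
    (g : α → ℝ) (h0 : ∀ u, 0 ≤ g u) (h1 : ∀ u, g u ≤ 1) (t : ℝ) (ht : 0 < t) (hm : t ≤ av g)
    (hb : ∀ i ∈ T, av (fun x => g x * ind (b i x ≠ 0)) ≤ av g / 4)
    (hs : ∀ i ∈ T, ∀ j ∈ T, i ≠ j → av (fun x => sg (b i x + b j x)) ≤ t / 8) :
    (T.card : ℝ) ≤ 8 / t := by
  set m := av g with hmdef
  have hmpos : 0 < m := lt_of_lt_of_le ht hm
  set s : ℝ := (T.card : ℝ) with hsdef
  have hs0 : 0 ≤ s := Nat.cast_nonneg _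
  have e1 : s * (m / 2) ≤ av (fun x => g x * ∑ i ∈ T, sg (b i x)) := by
    simp_rw [Finset.mul_sum]
    rw [av_sum]
    rw [hsdef, ← nsmul_eq_mul]
    apply Finset.card_nsmul_le_sum
    intro i hi
    have : av (fun x => g x * sg (b i x)) = m - 2 * av (fun x => g x * ind (b i x ≠ 0)) := by
      rw [hmdef, ← av_mul, ← av_sub]
      congr 1; ext x; rw [sg_ind]; ring
    rw [this]
    have := hb i hi
    linarith
  have e2 := av_cs g (fun x => ∑ i ∈ T, sg (b i x))
  have e3 : av (fun x => g x ^ 2) ≤ m := av_mono fun u => by nlinarith [h0 u, h1 u]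
  have e4 : av (fun x => (∑ i ∈ T, sg (b i x)) ^ 2) ≤ s + s ^ 2 * (t / 8) := by
    have : ∀ x, (∑ i ∈ T, sg (b i x)) ^ 2 = ∑ i ∈ T, ∑ j ∈ T, sg (b i x + b j x) := by
      intro x; rw [sq, Finset.sum_mul_sum]; simp_rw [sg_add]
    simp_rw [this]
    rw [av_sum]
    have : ∀ i ∈ T, av (fun x => ∑ j ∈ T, sg (b i x + b j x)) ≤ 1 + s * (t / 8) := by
      intro i hi
      rw [av_sum, ← Finset.add_sum_erase _ _ hi]
      have h5 : av (fun x => sg (b i x + b i x)) = 1 := by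
        simp_rw [self_add, sg_zero]; exact av_const 1
      rw [h5]
      have h6 : ∑ j ∈ T.erase i, av (fun x => sg (b i x + b j x)) ≤ (T.erase i).card • (t / 8) := by
        apply Finset.sum_le_card_nsmul
        intro j hj
        exact hs i hi j (Finset.mem_of_mem_erase hj) (Finset.ne_of_mem_erase hj).symm
      rw [nsmul_eq_mul] at h6
      have h7 : ((T.erase i).card : ℝ) ≤ s := by
        rw [hsdef]; exact_mod_cast Finset.card_le_card (Finset.erase_subset _ _)
      have : ((T.erase i).card : ℝ) * (t / 8) ≤ s * (t / 8) := by gcongr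
      linarith
    calc _ ≤ T.card • (1 + s * (t / 8)) := Finset.sum_le_card_nsmul _ _ _ this
      _ = _ := by rw [nsmul_eq_mul, ← hsdef]; ring
  have e5 : (s * (m / 2)) ^ 2 ≤ m * (s + s ^ 2 * (t / 8)) := by
    calc (s * (m / 2)) ^ 2 ≤ (av (fun x => g x * ∑ i ∈ T, sg (b i x))) ^ 2 := by gcongr
      _ ≤ _ := e2
      _ ≤ _ := mul_le_mul e3 e4 (av_nonneg fun u => sq_nonneg _) hmpos.le
  rw [le_div_iff₀ ht]
  by_contra hc
  push Not at hc
  have hspos : 0 < s := by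
    by_contra h
    have : s = 0 := by linarith
    rw [this] at hc; linarith
  have e6 : s * m * (s * m) ≤ s * m * (4 + s * t / 2) := by nlinarith
  have e7 : s * m ≤ 4 + s * t / 2 := le_of_mul_le_mul_left e6 (by positivity)
  have e8 : s * t ≤ s * m := by gcongr
  linarith

lemma pop_pigeon {α κ : Type*} [Fintype α] [Nonempty α] (A : Finset κ)
    (cond : κ → α → Prop) (g : α → ℝ) (h0 : ∀ u, 0 ≤ g u) (hg : 0 < av g) (p K : ℝ)
    (hA : ∀ a ∈ A, p * av g ≤ av (fun u => g u * ind (cond a u)))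
    (hK : ∀ u, ∀ T ⊆ A, (∀ a ∈ T, cond a u) → (T.card : ℝ) ≤ K) : A.card * p ≤ K := by
  classical
  have e1 : (A.card : ℝ) * (p * av g) ≤ av (fun u => g u * ∑ a ∈ A, ind (cond a u)) := by
    simp_rw [Finset.mul_sum]
    rw [av_sum, ← nsmul_eq_mul]
    exact Finset.card_nsmul_le_sum _ _ _ hA
  have e2 : av (fun u => g u * ∑ a ∈ A, ind (cond a u)) ≤ av (fun u => g u * K) := by
    apply av_mono
    intro u
    apply mul_le_mul_of_nonneg_left _ (h0 u)
    have := hK u (A.filter fun a => cond a u) (Finset.filter_subset _ _)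
      (fun a ha => (Finset.mem_filter.1 ha).2)
    rw [Finset.card_filter] at this
    push_cast at this
    have h9 : ∀ a, ind (cond a u) = if cond a u then 1 else 0 := by
      intro a; unfold ind; congr
    simp_rw [h9]
    exact this
  rw [av_mul'] at e2
  have : (A.card * p) * av g ≤ K * av g := by linarith
  exact le_of_mul_le_mul_right this hg

lemma max_sep {α : Type*} [Fintype α] (Pop : α → Prop) (R : α → α → Prop) (hR : ∀ a, R a a)
    (hsymm : ∀ a b, R a b → R b a) (K : ℝ)
    (h : ∀ A : Finset α, (∀ a ∈ A, Pop a) → (∀ a ∈ A, ∀ b ∈ A, a ≠ b → ¬ R a b) → (A.card : ℝ) ≤ K) :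
    ∃ A : Finset α, (A.card : ℝ) ≤ K ∧ (∀ a ∈ A, Pop a) ∧ ∀ a, Pop a → ∃ v ∈ A, R a v := by
  classical
  let F : Finset (Finset α) := Finset.univ.filter fun A =>
    (∀ a ∈ A, Pop a) ∧ (∀ a ∈ A, ∀ b ∈ A, a ≠ b → ¬ R a b)
  have hF : F.Nonempty := ⟨∅, by simp [F]⟩
  obtain ⟨A, hA, hmax⟩ := Finset.exists_max_image F Finset.card hF
  simp only [F, Finset.mem_filter, Finset.mem_univ, true_and] at hA hmax
  refine ⟨A, h A hA.1 hA.2, hA.1, fun a ha => ?_⟩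
  by_contra hc
  push Not at hc
  have haA : a ∉ A := fun h => hc a h (hR a)
  have := hmax (insert a A) ⟨?_, ?_⟩
  · rw [Finset.card_insert_of_notMem haA] at this; omega
  · intro b hb
    rcases Finset.mem_insert.1 hb with rfl | hb
    · exact ha
    · exact hA.1 b hb
  · intro b hb c hc' hbc
    rcases Finset.mem_insert.1 hb with hb1 | hb1 <;> rcases Finset.mem_insert.1 hc' with hc1 | hc1
    · exact absurd (hb1.trans hc1.symm) hbc
    · rw [hb1]; exact hc _ hc1
    · rw [hc1]; exact fun h => hc _ hb1 (hsymm _ _ h)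
    · exact hA.2 _ hb1 _ hc1 hbc

lemma LR_smul {Qs : Finset (Fin d) → Prop} {J : Finset (Fin d)} {C : ℕ} {f : Fn d n} (c : ZMod 2)
    (h : LR Qs J C f) : LR Qs J C (c • f) := by
  rcases zcases c with rfl | rfl
  · rw [zero_smul]; exact LR.zero _
  · rwa [one_smul]

lemma rearr {J P : Finset (Fin d)} (hPJ : P ⊆ J) (hPn : P.Nonempty) {Qs : Finset (Fin d) → Prop}
    {C C'' : ℕ} (a y : Fin C → Fn d n) (ha : ∀ i, a i ∈ ML d n P) (hy : ∀ i, y i ∈ ML d n (J \ P))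
    (Pop : Fn d n → Prop) (hPop : ∀ f, Pop f → f ∈ ML d n P)
    (A : Finset (Fn d n)) (hAPop : ∀ v ∈ A, Pop v)
    (hA : ∀ f, Pop f → ∃ v ∈ A, LR Qs P C'' (f + v))
    (g : Tup d n → ℝ) (h0 : ∀ u, 0 ≤ g u) (η : ℝ) (S : Finset (Finset (Fin d) × Fn d n))
    (hS : ∀ r ∈ ML d n (J \ P), av (fun u => g u * ind (r u ≠ 0)) ≤ η * av g → r ∈ Str (J \ P) S)
    (hbad : av (fun u => g u * ind (¬ Pop (∑ i, y i u • a i))) ≤ η * av g)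
    (S' : Finset (Finset (Fin d) × Fn d n)) (hSS' : S ⊆ S') (hAS : ∀ v ∈ A, (P, v) ∈ S') :
    ∃ w ∈ Str J S', LR Qs J (C * (2 ^ C * C'')) (∑ i, a i * y i + w) := by
  classical
  let Pf : Finset (Fn d n) := (Finset.univ.image (fun c : Fin C → ZMod 2 => ∑ i, c i • a i)).filter Pop
  have hPfc : Pf.card ≤ 2 ^ C := by
    refine (Finset.card_filter_le _ _).trans (Finset.card_image_le.trans ?_)
    simp [Finset.card_univ, ZMod.card]
  let Sp := Submodule.span (ZMod 2) (Pf : Set (Fn d n))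
  obtain ⟨π, hπ⟩ := Sp.subtype.exists_leftInverse_of_injective (Submodule.ker_subtype _)
  obtain ⟨κ, hκ⟩ := (Str (J \ P) S).subtype.exists_leftInverse_of_injective (Submodule.ker_subtype _)
  have hSpML : Sp ≤ ML d n P := Submodule.span_le.2 fun f hf =>
    hPop f (Finset.mem_filter.1 (Finset.mem_coe.1 hf)).2
  have hπ' : ∀ f ∈ Sp, (π f : Fn d n) = f := fun f hf => by
    have := LinearMap.congr_fun hπ ⟨f, hf⟩
    simpa using congrArg Subtype.val this
  have hκ' : ∀ f ∈ Str (J \ P) S, (κ f : Fn d n) = f := fun f hf => by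
    have := LinearMap.congr_fun hκ ⟨f, hf⟩
    simpa using congrArg Subtype.val this
  let b : Fin C → Fn d n := fun i => a i - (π (a i) : Fn d n)
  have hb : ∀ i, b i ∈ ML d n P := fun i => sub_mem (ha i) (hSpML (π (a i)).2)
  have hY : ∀ x, ∑ i, b i x • y i ∈ Str (J \ P) S := by
    intro x
    apply hS
    · exact Submodule.sum_mem _ fun i _ => Submodule.smul_mem _ _ (hy i)
    · refine le_trans (av_mono fun u => ?_) hbad
      apply mul_le_mul_of_nonneg_left _ (h0 u)
      apply ind_mono
      intro h1 h2
      apply h1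
      have hmem : ∑ i, y i u • a i ∈ Sp := by
        apply Submodule.subset_span
        rw [Finset.mem_coe, Finset.mem_filter]
        exact ⟨Finset.mem_image.2 ⟨fun i => y i u, Finset.mem_univ _, rfl⟩, h2⟩
      have h3 := hπ' _ hmem
      have h4 : ∑ i, y i u • b i = 0 := by
        simp only [b, smul_sub, Finset.sum_sub_distrib]
        rw [sub_eq_zero, ← h3, map_sum]
        simp
      have h5 := congrFun h4 x
      simp only [Finset.sum_apply, Pi.smul_apply, smul_eq_mul, Pi.zero_apply] at h5 ⊢
      rw [← h5]
      exact Finset.sum_congr rfl fun i _ => mul_comm _ _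
  have hzero : ∑ i, b i * (y i - (κ (y i) : Fn d n)) = 0 := by
    ext x
    have h1 := hκ' _ (hY x)
    rw [map_sum] at h1
    have h2 := congrFun h1 x
    simp only [map_smul, Submodule.coe_sum, Submodule.coe_smul, Finset.sum_apply, Pi.smul_apply, smul_eq_mul] at h2
    simp only [Finset.sum_apply, Pi.mul_apply, Pi.sub_apply, mul_sub, Finset.sum_sub_distrib, h2, sub_self, Pi.zero_apply]
  have hW2 : ∑ i, b i * (κ (y i) : Fn d n) ∈ Str J S' := by
    apply Submodule.sum_mem
    intro i _
    exact Str_mul Finset.disjoint_sdiff (Finset.union_sdiff_of_subset hPJ) (hb i)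
      (Str_mono hSS' (κ (y i)).2)
  have hcov : ∀ f : Fn d n, ∃ v, Pop f → v ∈ A ∧ LR Qs P C'' (f + v) := by
    intro f
    by_cases hf : Pop f
    · obtain ⟨v, h1, h2⟩ := hA f hf; exact ⟨v, fun _ => ⟨h1, h2⟩⟩
    · exact ⟨0, fun h => absurd h hf⟩
  choose v hv using hcov
  have hPf : ∀ f ∈ Pf, Pop f := fun f hf => (Finset.mem_filter.1 hf).2
  have hco : ∀ i, ∃ c : Fn d n → ZMod 2, ∑ f ∈ Pf, c f • f = (π (a i) : Fn d n) := by
    intro i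
    obtain ⟨c, _, hc⟩ := Submodule.mem_span_finset.1 (π (a i)).2
    exact ⟨c, hc⟩
  choose c hc using hco
  refine ⟨∑ i, ∑ f ∈ Pf, c i f • (v f * y i) - ∑ i, b i * (κ (y i) : Fn d n), sub_mem ?_ hW2, ?_⟩
  · apply Submodule.sum_mem; intro i _
    apply Submodule.sum_mem; intro f hf
    apply Submodule.smul_mem
    apply Submodule.subset_span
    exact ⟨(P, v f), hAS _ (hv f (hPf f hf)).1, hPn, hPJ,
      hPop _ (hAPop _ (hv f (hPf f hf)).1), y i, hy i, rfl⟩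
  · have key : ∑ i, a i * y i + (∑ i, ∑ f ∈ Pf, c i f • (v f * y i) - ∑ i, b i * (κ (y i) : Fn d n))
        = ∑ i : Fin C, ∑ f ∈ Pf, c i f • ((f + v f) * y i) := by
      have h1 : ∑ i, a i * y i = ∑ i, (π (a i) : Fn d n) * y i + ∑ i, b i * (κ (y i) : Fn d n)
          + ∑ i, b i * (y i - (κ (y i) : Fn d n)) := by
        rw [← Finset.sum_add_distrib, ← Finset.sum_add_distrib]
        refine Finset.sum_congr rfl fun i _ => ?_
        simp only [b]; ring
      rw [h1, hzero]
      have h2 : ∑ i, (π (a i) : Fn d n) * y i = ∑ i, ∑ f ∈ Pf, c i f • (f * y i) := by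
        refine Finset.sum_congr rfl fun i _ => ?_
        rw [← hc i, Finset.sum_mul]
        simp
      rw [h2]
      simp only [add_mul, smul_add, Finset.sum_add_distrib]
      abel
    rw [key]
    have h1 : ∀ i : Fin C, LR Qs J (2 ^ C * C'') (∑ f ∈ Pf, c i f • ((f + v f) * y i)) := by
      intro i
      refine LR_mono (Nat.mul_le_mul_right _ hPfc) (fun _ _ h => h) (LR_sum Pf C'' _ fun f hf => ?_)
      exact LR_smul _ (LR_mulr hPJ (hv f (hPf f hf)).2 (hy i))
    have := LR_sum (Finset.univ : Finset (Fin C)) (2 ^ C * C'') _ fun i _ => h1 i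
    simpa using this

end stepA
section stepB
variable {d : ℕ}

lemma pw_pw {n : Fin d → ℕ} (P : Finset (Fin d)) (x y u : Tup d n) :
    P.piecewise x (P.piecewise y u) = P.piecewise x u := by
  ext1 i; by_cases hi : i ∈ P <;> simp [hi]

lemma av_ind_pw {n : Fin d → ℕ} (P : Finset (Fin d)) (g : Tup d n → ℝ) (h : Tup d n → Prop)
    (hh : ∀ x u, h (P.piecewise x u) = h u) :
    av (fun u => g u * ind (h u)) = av (fun u => av (fun x => g (P.piecewise x u)) * ind (h u)) := by
  rw [← av_pw P (fun u => g u * ind (h u))]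
  congr 1; ext u
  simp_rw [hh]
  rw [av_mul']

lemma STEP {J P : Finset (Fin d)} {j : Fin d} (hPJ : P ⊆ J) (hj : j ∈ P)
    (Qs : Finset (Fin d) → Prop) (hQ : ∀ Q, Qs Q → j ∈ Q ∧ ¬ P ⊆ Q)
    (hP1 : PP d (P.erase j)) (hP2 : PP d (J \ P)) :
    ∃ η0 : ℝ, 0 < η0 ∧ ∀ δ : ℝ, 0 < δ → ∀ C : ℕ, ∃ k' C' : ℕ,
      ∀ (n : Fin d → ℕ) (g : Tup d n → ℝ),
      (∀ u, 0 ≤ g u) → (∀ u, g u ≤ 1) → δ ≤ av g →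
      ∃ S : Finset (Finset (Fin d) × Fn d n), S.card ≤ k' ∧ ∀ r, LR (fun Q => Qs Q ∨ Q = P) J C r →
        av (fun u => g u * ind (r u ≠ 0)) ≤ η0 * av g →
        ∃ w ∈ Str J S, LR (fun Q => Qs Q ∨ (j ∈ Q ∧ Q ≠ P ∧ Q ⊆ P)) J C' (r + w) := by
  classical
  obtain ⟨η', hη', H2⟩ := hP2
  refine ⟨η' / 6, by positivity, fun δ hδ C => ?_⟩
  set η0 := η' / 6 with hη0def
  have hη0 : 0 < η0 := by positivity
  set t := η0 * δ with htdef
  have ht : 0 < t := by positivity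
  set p := η0 / 2 ^ C with hpdef
  have hp : 0 < p := by positivity
  obtain ⟨CB, HB⟩ := BP hj hP1 (t / 8) (by positivity)
  obtain ⟨k2, H2⟩ := H2 δ hδ
  set C'' := CB + C + C with hC''
  refine ⟨⌈8 / t / p⌉₊ + k2, C * (2 ^ C * C'') + C, fun n g h0 h1 hav => ?_⟩
  have hM0 : 0 < av g := lt_of_lt_of_le hδ hav
  obtain ⟨S2, hS2c, hS2⟩ := H2 n g h0 h1 hav
  let m : Tup d n → ℝ := fun u => av (fun x => g (P.piecewise x u))
  let cond : Fn d n → Tup d n → Prop := fun a u => t ≤ m u ∧ ∃ l : Fn d n,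
    LR (fun Q => j ∈ Q ∧ Q ≠ P) P C l ∧
      av (fun x => g (P.piecewise x u) * ind (a x + l x ≠ 0)) ≤ m u / 4
  let Pop : Fn d n → Prop := fun a => a ∈ ML d n P ∧ p * av g ≤ av (fun u => g u * ind (cond a u))
  let R : Fn d n → Fn d n → Prop := fun a b => LR (fun Q => j ∈ Q ∧ Q ≠ P) P C'' (a + b)
  have hsep : ∀ A : Finset (Fn d n), (∀ a ∈ A, Pop a) → (∀ a ∈ A, ∀ b ∈ A, a ≠ b → ¬ R a b) →
      (A.card : ℝ) ≤ 8 / t / p := by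
    intro A hA hAR
    rw [le_div_iff₀ hp]
    apply pop_pigeon A cond g h0 hM0 p (8 / t) (fun a ha => (hA a ha).2)
    intro u T hT hTc
    by_cases hTn : T = ∅
    · subst hTn; simp; positivity
    obtain ⟨a0, ha0⟩ := Finset.nonempty_iff_ne_empty.2 hTn
    have hl : ∀ a : Fn d n, ∃ l : Fn d n, a ∈ T → LR (fun Q => j ∈ Q ∧ Q ≠ P) P C l ∧
      av (fun x => g (P.piecewise x u) * ind (a x + l x ≠ 0)) ≤ m u / 4 := by
      intro a
      by_cases ha : a ∈ T
      · obtain ⟨l, hl⟩ := (hTc a ha).2; exact ⟨l, fun _ => hl⟩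
      · exact ⟨0, fun h => absurd h ha⟩
    choose l hl using hl
    refine cs_bound T (fun a x => a x + l a x) (fun x => g (P.piecewise x u)) (fun x => h0 _)
      (fun x => h1 _) t ht (hTc a0 ha0).1 (fun a ha => (hl a ha).2) ?_
    intro a ha b hb hab
    by_contra hcon
    push Not at hcon
    have hLR := HB n ((a + l a) + (b + l b))
      (add_mem (add_mem (hA a (hT ha)).1 (LR_ML (hl a ha).1)) (add_mem (hA b (hT hb)).1 (LR_ML (hl b hb).1)))
      hcon.le
    apply hAR a (hT ha) b (hT hb) hab
    have h3 := LR_add (LR_add hLR (hl a ha).1) (hl b hb).1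
    have h4 : (a + l a) + (b + l b) + l a + l b = a + b := by
      have e1 := self_add (l a)
      have e2 := self_add (l b)
      calc (a + l a) + (b + l b) + l a + l b = a + b + (l a + l a) + (l b + l b) := by abel
        _ = a + b := by rw [e1, e2]; simp
    rw [h4] at h3
    exact h3
  obtain ⟨A, hAc, hAPop, hAcov⟩ := max_sep Pop R
    (fun a => by simp only [R, self_add]; exact LR.zero _)
    (fun a b h => by simp only [R] at h ⊢; rwa [add_comm]) _ hsep
  refine ⟨A.image (fun v => (P, v)) ∪ S2, ?_, ?_⟩
  · refine (Finset.card_union_le _ _).trans ?_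
    have e1 : (A.image (fun v => (P, v))).card ≤ A.card := Finset.card_image_le
    have e2 : A.card ≤ ⌈8 / t / p⌉₊ := by
      have := hAc.trans (Nat.le_ceil _)
      exact_mod_cast this
    omega
  intro r hr hrbad
  obtain ⟨a, y, ha, hy, r', hr', rfl⟩ := LR_split hr
  set r := ∑ i, a i * y i + r' with hrdef
  let e : Tup d n → ℝ := fun u => av (fun x => g (P.piecewise x u) * ind (r (P.piecewise x u) ≠ 0))
  have hav_e : av e ≤ η0 * av g := by
    have := av_pw P (fun u => g u * ind (r u ≠ 0))
    simp only [e]; rw [this]; exact hrbad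
  have hm0 : ∀ u, 0 ≤ m u := fun u => av_nonneg fun x => h0 _
  have he0 : ∀ u, 0 ≤ e u := fun u => av_nonneg fun x => mul_nonneg (h0 _) (ind_nonneg _)
  have hmpw : ∀ x u, m (P.piecewise x u) = m u := by intro x u; simp only [m, pw_pw]
  have hepw : ∀ x u, e (P.piecewise x u) = e u := by intro x u; simp only [e, pw_pw]
  have hd1 : av (fun u => g u * ind (m u < t)) ≤ t := by
    rw [av_ind_pw P g (fun u => m u < t) (fun x u => by rw [hmpw])]
    refine le_trans (av_mono (g := fun _ => t) ?_) (av_const t).le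
    intro u
    change m u * ind (m u < t) ≤ t
    by_cases h : m u < t
    · rw [ind_true h]; linarith
    · rw [ind_false h]; linarith
  have hd2 : av (fun u => g u * ind (m u < 4 * e u)) ≤ 4 * (η0 * av g) := by
    rw [av_ind_pw P g (fun u => m u < 4 * e u) (fun x u => by rw [hmpw, hepw])]
    refine le_trans ?_ (mul_le_mul_of_nonneg_left hav_e (by norm_num))
    rw [← av_mul]
    apply av_mono
    intro u
    change m u * ind (m u < 4 * e u) ≤ 4 * e u
    have := he0 u
    by_cases h : m u < 4 * e u
    · rw [ind_true h]; linarith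
    · rw [ind_false h]; linarith
  let au : Tup d n → Fn d n := fun u => ∑ i, y i u • a i
  let ac : (Fin C → ZMod 2) → Fn d n := fun c => ∑ i, c i • a i
  have hac : ∀ c, ac c ∈ ML d n P := fun c =>
    Submodule.sum_mem _ fun i _ => Submodule.smul_mem _ _ (ha i)
  have hcond : ∀ u, ¬ m u < t → ¬ m u < 4 * e u → cond (au u) u := by
    intro u hu1 hu2
    push Not at hu1 hu2
    refine ⟨hu1, fun x => r' (P.piecewise x u), LR_contract hPJ hj hQ hr' u, ?_⟩
    have : ∀ x, (au u) x + r' (P.piecewise x u) = r (P.piecewise x u) := by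
      intro x
      simp only [au, hrdef, Pi.add_apply, Finset.sum_apply, Pi.mul_apply, Pi.smul_apply, smul_eq_mul]
      congr 1
      refine Finset.sum_congr rfl fun i _ => ?_
      rw [ML_pw_eq' (ha i) u x P (Finset.Subset.refl _), ML_pw_eq (hy i) u x P Finset.disjoint_sdiff]
      ring
    simp_rw [this]
    change e u ≤ m u / 4
    linarith
  have hd3 : av (fun u => g u * ∑ c, ind (¬ Pop (ac c)) * ind (cond (ac c) u)) ≤ η0 * av g := by
    simp_rw [Finset.mul_sum]
    rw [av_sum]
    have : ∀ c ∈ (Finset.univ : Finset (Fin C → ZMod 2)),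
        av (fun u => g u * (ind (¬ Pop (ac c)) * ind (cond (ac c) u))) ≤ p * av g := by
      intro c _
      by_cases hc : Pop (ac c)
      · simp_rw [ind_false (not_not.2 hc)]
        simp only [zero_mul, mul_zero]
        rw [av_const]; positivity
      · simp_rw [ind_true hc, one_mul]
        by_contra hcon
        push Not at hcon
        exact hc ⟨hac c, hcon.le⟩
    refine (Finset.sum_le_card_nsmul _ _ _ this).trans ?_
    rw [nsmul_eq_mul]
    have : ((Finset.univ : Finset (Fin C → ZMod 2)).card : ℝ) = 2 ^ C := by
      simp [Finset.card_univ, ZMod.card]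
    rw [this, hpdef]
    apply le_of_eq
    field_simp
  have hbad : av (fun u => g u * ind (¬ Pop (∑ i, y i u • a i))) ≤ η' * av g := by
    have e1 : av (fun u => g u * ind (¬ Pop (∑ i, y i u • a i))) ≤
        av (fun u => (g u * ind (m u < t) + g u * ind (m u < 4 * e u)) +
          g u * ∑ c, ind (¬ Pop (ac c)) * ind (cond (ac c) u)) := by
      apply av_mono
      intro u
      rw [← mul_add, ← mul_add]
      apply mul_le_mul_of_nonneg_left _ (h0 u)
      have hs0 : 0 ≤ ∑ c, ind (¬ Pop (ac c)) * ind (cond (ac c) u) :=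
        Finset.sum_nonneg fun c _ => mul_nonneg (ind_nonneg _) (ind_nonneg _)
      have i1 := ind_nonneg (m u < t)
      have i2 := ind_nonneg (m u < 4 * e u)
      have i3 := ind_le_one (¬ Pop (∑ i, y i u • a i))
      by_cases hu1 : m u < t
      · rw [ind_true hu1]; linarith
      by_cases hu2 : m u < 4 * e u
      · rw [ind_true hu2]; linarith
      have hc := hcond u hu1 hu2
      have : ind (¬ Pop (ac fun i => y i u)) * ind (cond (ac fun i => y i u) u) ≤
          ∑ c, ind (¬ Pop (ac c)) * ind (cond (ac c) u) :=
        Finset.single_le_sum (f := fun c => ind (¬ Pop (ac c)) * ind (cond (ac c) u))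
          (fun c _ => mul_nonneg (ind_nonneg _) (ind_nonneg _)) (Finset.mem_univ (fun i => y i u))
      have hc' : cond (ac fun i => y i u) u := hc
      rw [ind_true hc', mul_one] at this
      change ind (¬ Pop (ac fun i => y i u)) ≤ _
      linarith
    rw [av_add, av_add] at e1
    have e2 : t ≤ η0 * av g := by rw [htdef]; gcongr
    have e3 : η' * av g = 6 * (η0 * av g) := by rw [hη0def]; ring
    linarith
  obtain ⟨w, hw, hLR⟩ := rearr (Qs := fun Q => j ∈ Q ∧ Q ≠ P ∧ Q ⊆ P) hPJ ⟨j, hj⟩ a y ha hy Pop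
    (fun f hf => hf.1) A hAPop
    (fun f hf => by
      obtain ⟨v, hv, h⟩ := hAcov f hf
      exact ⟨v, hv, LR_mono le_rfl (fun Q hQP h => ⟨h.1, h.2, hQP⟩) h⟩) g h0 η' S2 hS2 hbad
    (A.image (fun v => (P, v)) ∪ S2) Finset.subset_union_right
    (fun v hv => Finset.mem_union_left _ (Finset.mem_image_of_mem _ hv))
  refine ⟨w, hw, ?_⟩
  have : r + w = (∑ i, a i * y i + w) + r' := by rw [hrdef]; abel
  rw [this]
  exact LR_add (LR_mono le_rfl (fun Q _ h => Or.inr h) hLR) (LR_mono le_rfl (fun Q _ h => Or.inl h) hr')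

end stepB
section dbl
variable {d : ℕ} {n : Fin d → ℕ}

lemma av_upd (i : Fin d) (F : Tup d n → ℝ) :
    av (fun u => av (fun x : Tup d n => F (Function.update u i (x i)))) = av F := by
  have := av_pw {i} F
  simp_rw [pw_singleton] at this
  exact this

lemma dbl_av (i : Fin d) (p q m : Tup d n → ℝ) (hm : ∀ u x, m (Function.update u i x) = m u) :
    av (fun u => av (fun x : Tup d n => p (Function.update u i (x i)) *
      q (Function.update u i (x i + u i))) / m u) =
    av (fun u => av (fun x : Tup d n => p (Function.update u i (x i))) *
      av (fun x : Tup d n => q (Function.update u i (x i))) / m u) := by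
  rw [← av_upd i (fun u => av (fun x : Tup d n => p (Function.update u i (x i)) *
      q (Function.update u i (x i + u i))) / m u)]
  congr 1; ext u
  simp only [hm, Function.update_idem, Function.update_self]
  simp_rw [div_eq_mul_inv]
  rw [av_mul', av_comm]
  congr 1
  have : ∀ x : Tup d n, av (fun y : Tup d n => q (Function.update u i (x i + y i)))
      = av (fun y : Tup d n => q (Function.update u i (y i))) := by
    intro x
    exact av_equiv (Equiv.addLeft x) (fun y : Tup d n => q (Function.update u i (y i)))
  simp_rw [av_mul, this]
  rw [av_mul']

lemma D1 (i : Fin d) (g : Tup d n → ℝ) (h0 : ∀ u, 0 ≤ g u) (h1 : ∀ u, g u ≤ 1) :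
    ∃ g' : Tup d n → ℝ, (∀ u, 0 ≤ g' u) ∧ (∀ u, g' u ≤ 1) ∧ av g' = av g ∧
      ∀ F F' : Fn d n, (∀ u x : Tup d n, F' u = F (Function.update u i (x i)) +
        F (Function.update u i (x i + u i))) →
        av (fun u => g' u * ind (F' u ≠ 0)) ≤ 2 * av (fun u => g u * ind (F u ≠ 0)) := by
  let m : Tup d n → ℝ := fun u => av (fun x : Tup d n => g (Function.update u i (x i)))
  have hm : ∀ u x, m (Function.update u i x) = m u := by
    intro u x; simp only [m, Function.update_idem]
  have hm0 : ∀ u, 0 ≤ m u := fun u => av_nonneg fun x => h0 _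
  let g' : Tup d n → ℝ := fun u => av (fun x : Tup d n => g (Function.update u i (x i)) *
      g (Function.update u i (x i + u i))) / m u
  refine ⟨g', ?_, ?_, ?_, ?_⟩
  · intro u
    exact div_nonneg (av_nonneg fun x => mul_nonneg (h0 _) (h0 _)) (hm0 u)
  · intro u
    apply div_le_one_of_le₀ _ (hm0 u)
    exact av_mono fun x => mul_le_of_le_one_right (h0 _) (h1 _)
  · have := dbl_av i g g m hm
    simp only [g']
    rw [this, ← av_upd i g]
    congr 1; ext u
    change m u * m u / m u = m u
    by_cases h : m u = 0
    · rw [h]; simp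
    · field_simp
  · intro F F' hF
    let b : Tup d n → ℝ := fun u => g u * ind (F u ≠ 0)
    have hb0 : ∀ u, 0 ≤ b u := fun u => mul_nonneg (h0 _) (ind_nonneg _)
    have e1 : av (fun u => g' u * ind (F' u ≠ 0)) ≤ av (fun u =>
        av (fun x : Tup d n => b (Function.update u i (x i)) * g (Function.update u i (x i + u i))) / m u +
        av (fun x : Tup d n => g (Function.update u i (x i)) * b (Function.update u i (x i + u i))) / m u) := by
      apply av_mono
      intro u
      simp only [g']
      rw [div_mul_eq_mul_div, ← add_div, ← av_mul', ← av_add]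
      apply div_le_div_of_nonneg_right _ (hm0 u)
      apply av_mono
      intro x
      simp only [b]
      set A := F (Function.update u i (x i)) with hA
      set B := F (Function.update u i (x i + u i)) with hB
      have h3 : ind (F' u ≠ 0) ≤ ind (A ≠ 0) + ind (B ≠ 0) := by
        rw [hF u x]
        by_cases ha : A = 0
        · by_cases hb : B = 0
          · rw [ind_false (by simp [← hA, ← hB, ha, hb])]
            exact add_nonneg (ind_nonneg _) (ind_nonneg _)
          · rw [ind_true (p := B ≠ 0) hb]
            have := ind_le_one (F (Function.update u i (x i)) + F (Function.update u i (x i + u i)) ≠ 0)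
            have := ind_nonneg (A ≠ 0)
            linarith
        · rw [ind_true (p := A ≠ 0) ha]
          have := ind_le_one (F (Function.update u i (x i)) + F (Function.update u i (x i + u i)) ≠ 0)
          have := ind_nonneg (B ≠ 0)
          linarith
      have h4 := mul_le_mul_of_nonneg_left h3 (mul_nonneg (h0 (Function.update u i (x i)))
        (h0 (Function.update u i (x i + u i))))
      linarith
    refine e1.trans ?_
    rw [av_add, dbl_av i b g m hm, dbl_av i g b m hm, ← av_add, ← av_mul,
      ← av_upd i (fun u => 2 * (g u * ind (F u ≠ 0)))]
    apply av_mono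
    intro u
    rw [av_mul]
    set β := av (fun x : Tup d n => b (Function.update u i (x i))) with hβ
    change β * m u / m u + m u * β / m u ≤ 2 * β
    have hβ0 : 0 ≤ β := av_nonneg fun x => hb0 _
    by_cases h : m u = 0
    · rw [h]; simp; exact hβ0
    · apply le_of_eq; field_simp; ring

lemma ML_d1 {I : Finset (Fin d)} {f : Fn d n} (hf : f ∈ ML d n I) (i : Fin d) (u x : Tup d n) :
    f (Function.update u i (x i)) + f (Function.update u i (x i + u i)) = if i ∈ I then f u else 0 := by
  split
  · rename_i h
    rw [ML_lin hf h, ← add_assoc, self_add, zero_add, Function.update_eq_self]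
  · rename_i h
    rw [ML_ind hf h, ML_ind hf h, self_add]

lemma DBLs (J : Finset (Fin d)) (g : Tup d n → ℝ) (h0 : ∀ u, 0 ≤ g u) (h1 : ∀ u, g u ≤ 1)
    (s : Finset (Fin d)) (hs : s ⊆ J) :
    ∃ g' : Tup d n → ℝ, (∀ u, 0 ≤ g' u) ∧ (∀ u, g' u ≤ 1) ∧ av g' = av g ∧
      ∀ r ∈ ML d n J, ∀ (τ : Finset (Finset (Fin d) × Fn d n)) (z : Finset (Fin d) × Fn d n → Fn d n),
        (∀ p ∈ τ, z p ∈ ML d n (J \ p.1)) →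
        av (fun u => g' u * ind ((r + ∑ p ∈ τ with Disjoint s p.1, z p) u ≠ 0)) ≤
          2 ^ s.card * av (fun u => g u * ind ((r + ∑ p ∈ τ, z p) u ≠ 0)) := by
  classical
  induction s using Finset.induction_on with
  | empty =>
    refine ⟨g, h0, h1, rfl, fun r hr τ z hz => ?_⟩
    simp
  | insert i s hi ih =>
    rw [Finset.insert_subset_iff] at hs
    obtain ⟨g1, a0, a1, a2, a3⟩ := ih hs.2
    obtain ⟨g2, b0, b1, b2, b3⟩ := D1 i g1 a0 a1
    refine ⟨g2, b0, b1, b2.trans a2, fun r hr τ z hz => ?_⟩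
    have e1 := a3 r hr τ z hz
    have e2 := b3 (r + ∑ p ∈ τ with Disjoint s p.1, z p)
      (r + ∑ p ∈ τ with Disjoint (insert i s) p.1, z p) ?_
    · rw [Finset.card_insert_of_notMem hi, pow_succ]
      linarith
    · intro u x
      simp only [Pi.add_apply, Finset.sum_apply]
      rw [add_add_add_comm, ← Finset.sum_add_distrib, ML_d1 hr, if_pos hs.1]
      congr 1
      simp only [Finset.disjoint_insert_left]
      have : (τ.filter fun p => i ∉ p.1 ∧ Disjoint s p.1) = (τ.filter fun p => Disjoint s p.1).filter fun p => i ∉ p.1 := by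
        ext p; simp only [Finset.mem_filter]; tauto
      rw [this, Finset.sum_filter]
      refine Finset.sum_congr rfl fun p hp => ?_
      rw [ML_d1 (hz p (Finset.mem_filter.1 hp).1)]
      simp [hs.1]

lemma DBL (J : Finset (Fin d)) (g : Tup d n → ℝ) (h0 : ∀ u, 0 ≤ g u) (h1 : ∀ u, g u ≤ 1) :
    ∃ g' : Tup d n → ℝ, (∀ u, 0 ≤ g' u) ∧ (∀ u, g' u ≤ 1) ∧ av g' = av g ∧
      ∀ r ∈ ML d n J, ∀ (τ : Finset (Finset (Fin d) × Fn d n)) (z : Finset (Fin d) × Fn d n → Fn d n),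
        (∀ p ∈ τ, p.1.Nonempty ∧ p.1 ⊆ J ∧ z p ∈ ML d n (J \ p.1)) →
        av (fun u => g' u * ind (r u ≠ 0)) ≤
          2 ^ d * av (fun u => g u * ind ((r + ∑ p ∈ τ, z p) u ≠ 0)) := by
  classical
  obtain ⟨g', a0, a1, a2, a3⟩ := DBLs J g h0 h1 J (Finset.Subset.refl _)
  refine ⟨g', a0, a1, a2, fun r hr τ z hz => ?_⟩
  have e := a3 r hr τ z (fun p hp => (hz p hp).2.2)
  have e1 : (τ.filter fun p => Disjoint J p.1) = ∅ := by
    rw [Finset.filter_eq_empty_iff]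
    intro p hp hd
    obtain ⟨⟨i, hi⟩, h2, _⟩ := hz p hp
    exact Finset.disjoint_left.1 hd (h2 hi) hi
  rw [e1] at e
  simp only [Finset.sum_empty, add_zero] at e
  refine e.trans (mul_le_mul_of_nonneg_right ?_ (av_nonneg fun u => mul_nonneg (h0 _) (ind_nonneg _)))
  apply pow_le_pow_right₀ (by norm_num)
  simpa using Finset.card_le_univ J

lemma PIG {α κ : Type*} [Fintype α] [DecidableEq κ] (S : Finset κ) (k : ℕ) (hS : S.card ≤ k)
    (σ : α → Finset κ) (hσ : ∀ u, σ u ⊆ S)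
    (g : α → ℝ) (h0 : ∀ u, 0 ≤ g u) (hg : 0 < av g) (bad : α → Prop) (η : ℝ) (hη : 0 < η)
    (hbad : av (fun u => g u * ind (bad u)) ≤ η * av g) :
    ∃ τ ⊆ S, av g / 2 ^ (k + 1) ≤ av (fun u => g u * ind (σ u = τ)) ∧
      av (fun u => (g u * ind (σ u = τ)) * ind (bad u)) ≤ 2 * η * av (fun u => g u * ind (σ u = τ)) := by
  classical
  by_contra hcon
  push Not at hcon
  have hone : ∀ u, ∑ τ ∈ S.powerset, ind (σ u = τ) = 1 := by
    intro u
    rw [Finset.sum_eq_single (σ u)]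
    · exact ind_true rfl
    · intro b _ hb; exact ind_false (Ne.symm hb)
    · intro h; exact absurd (Finset.mem_powerset.2 (hσ u)) h
  have s1 : ∑ τ ∈ S.powerset, av (fun u => g u * ind (σ u = τ)) = av g := by
    rw [← av_sum]
    congr 1; ext u
    rw [← Finset.mul_sum, hone, mul_one]
  have s2 : ∑ τ ∈ S.powerset, av (fun u => (g u * ind (σ u = τ)) * ind (bad u)) =
      av (fun u => g u * ind (bad u)) := by
    rw [← av_sum]
    congr 1; ext u
    rw [← Finset.sum_mul, ← Finset.mul_sum, hone, mul_one]
  have hlt : ∑ τ ∈ S.powerset, 2 * η * (av (fun u => g u * ind (σ u = τ)) - av g / 2 ^ (k + 1)) <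
      ∑ τ ∈ S.powerset, av (fun u => (g u * ind (σ u = τ)) * ind (bad u)) := by
    apply Finset.sum_lt_sum_of_nonempty ⟨∅, by simp⟩
    intro τ hτ
    have hpos : 0 < av g / 2 ^ (k + 1) := by positivity
    by_cases h : av g / 2 ^ (k + 1) ≤ av (fun u => g u * ind (σ u = τ))
    · have := hcon τ (Finset.mem_powerset.1 hτ) h
      nlinarith
    · push Not at h
      have h2 : 0 ≤ av (fun u => (g u * ind (σ u = τ)) * ind (bad u)) :=
        av_nonneg fun u => mul_nonneg (mul_nonneg (h0 _) (ind_nonneg _)) (ind_nonneg _)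
      nlinarith
  rw [s2, ← Finset.mul_sum, Finset.sum_sub_distrib, s1, Finset.sum_const, Finset.card_powerset,
    nsmul_eq_mul] at hlt
  have h5 : ((2 ^ S.card : ℕ) : ℝ) * (av g / 2 ^ (k + 1)) ≤ av g / 2 := by
    have : ((2 ^ S.card : ℕ) : ℝ) ≤ 2 ^ k := by
      push_cast; exact pow_le_pow_right₀ (by norm_num) hS
    calc ((2 ^ S.card : ℕ) : ℝ) * (av g / 2 ^ (k + 1)) ≤ 2 ^ k * (av g / 2 ^ (k + 1)) := by gcongr
      _ = av g / 2 := by rw [pow_succ]; field_simp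
  nlinarith

end dbl
section claim
variable {d : ℕ}

lemma CLAIM {J : Finset (Fin d)} {j : Fin d} (hj : j ∈ J) (hIH : ∀ K, K ⊂ J → PP d K) (N : ℕ) :
    ∀ D : Finset (Finset (Fin d)), D.card = N → (∀ Q ∈ D, j ∈ Q ∧ Q ⊆ J) →
      (∀ Q ∈ D, ∀ Q', Q' ⊆ Q → j ∈ Q' → Q' ∈ D) →
      ∃ η : ℝ, 0 < η ∧ ∀ δ : ℝ, 0 < δ → ∀ C : ℕ, ∃ k : ℕ, ∀ (n : Fin d → ℕ) (g : Tup d n → ℝ),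
        (∀ u, 0 ≤ g u) → (∀ u, g u ≤ 1) → δ ≤ av g →
        ∃ S : Finset (Finset (Fin d) × Fn d n), S.card ≤ k ∧ ∀ r, LR (fun Q => Q ∈ D) J C r →
          av (fun u => g u * ind (r u ≠ 0)) ≤ η * av g → r ∈ Str J S := by
  classical
  induction N with
  | zero =>
    intro D hD _ _
    rw [Finset.card_eq_zero] at hD
    subst hD
    refine ⟨1, one_pos, fun δ _ C => ⟨0, fun n g _ _ _ => ⟨∅, by simp, fun r hr _ => ?_⟩⟩⟩
    cases hr with
    | zero => exact zero_mem _
    | add h => exact absurd h (by simp)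
  | succ N ih =>
    intro D hD hDJ hdown
    have hne : D.Nonempty := by rw [← Finset.card_pos]; omega
    obtain ⟨P, hPD, hmax⟩ := Finset.exists_max_image D Finset.card hne
    have hjP := (hDJ P hPD).1
    have hPJ := (hDJ P hPD).2
    have hnot : ∀ Q ∈ D.erase P, ¬ P ⊆ Q := by
      intro Q hQ hPQ
      rw [Finset.mem_erase] at hQ
      exact hQ.1 (Finset.eq_of_subset_of_card_le hPQ (hmax Q hQ.2)).symm
    obtain ⟨η0, hη0, H0⟩ := STEP hPJ hjP (fun Q => Q ∈ D.erase P)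
      (fun Q hQ => ⟨(hDJ Q (Finset.mem_of_mem_erase hQ)).1, hnot Q hQ⟩)
      (hIH _ (Finset.ssubset_iff_subset_ne.2 ⟨(Finset.erase_subset _ _).trans hPJ,
        fun h => Finset.notMem_erase j P (h ▸ hj)⟩))
      (hIH _ (Finset.ssubset_iff_subset_ne.2 ⟨Finset.sdiff_subset,
        fun h => (Finset.mem_sdiff.1 (h.symm ▸ hj : j ∈ J \ P)).2 hjP⟩))
    obtain ⟨η1, hη1, H1⟩ := ih (D.erase P) (by rw [Finset.card_erase_of_mem hPD, hD]; rfl)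
      (fun Q hQ => hDJ Q (Finset.mem_of_mem_erase hQ))
      (fun Q hQ Q' hQ' hjQ' => Finset.mem_erase.2
        ⟨fun h => hnot Q hQ (h ▸ hQ'), hdown Q (Finset.mem_of_mem_erase hQ) Q' hQ' hjQ'⟩)
    refine ⟨min η0 (η1 / 2 ^ (d + 1)), lt_min hη0 (by positivity), fun δ hδ C => ?_⟩
    set η := min η0 (η1 / 2 ^ (d + 1)) with hηdef
    have hη : 0 < η := lt_min hη0 (by positivity)
    obtain ⟨k1, C1, H0⟩ := H0 δ hδ C
    obtain ⟨k2, H1⟩ := H1 (δ / 2 ^ (k1 + 1)) (by positivity) C1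
    refine ⟨k1 + 2 ^ k1 * k2, fun n g h0 h1 hav => ?_⟩
    have hM0 : 0 < av g := lt_of_lt_of_le hδ hav
    obtain ⟨S1, hS1c, hS1⟩ := H0 n g h0 h1 hav
    let σ : Tup d n → Finset (Finset (Fin d) × Fn d n) := fun u => S1.filter fun p => p.2 u = 1
    have hτ : ∀ τ : Finset (Finset (Fin d) × Fn d n), ∃ (g' : Tup d n → ℝ)
        (S : Finset (Finset (Fin d) × Fn d n)), S.card ≤ k2 ∧
        av g' = av (fun u => g u * ind (σ u = τ)) ∧
        (∀ r ∈ ML d n J, ∀ (τ' : Finset (Finset (Fin d) × Fn d n)) (z : Finset (Fin d) × Fn d n → Fn d n),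
          (∀ p ∈ τ', p.1.Nonempty ∧ p.1 ⊆ J ∧ z p ∈ ML d n (J \ p.1)) →
          av (fun u => g' u * ind (r u ≠ 0)) ≤
            2 ^ d * av (fun u => (g u * ind (σ u = τ)) * ind ((r + ∑ p ∈ τ', z p) u ≠ 0))) ∧
        (δ / 2 ^ (k1 + 1) ≤ av g' → ∀ r, LR (fun Q => Q ∈ D.erase P) J C1 r →
          av (fun u => g' u * ind (r u ≠ 0)) ≤ η1 * av g' → r ∈ Str J S) := by
      intro τ
      obtain ⟨g', a0, a1, a2, a3⟩ := DBL J (fun u => g u * ind (σ u = τ))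
        (fun u => mul_nonneg (h0 u) (ind_nonneg _))
        (fun u => mul_le_one₀ (h1 u) (ind_nonneg _) (ind_le_one _))
      by_cases h : δ / 2 ^ (k1 + 1) ≤ av g'
      · obtain ⟨S, hSc, hS⟩ := H1 n g' a0 a1 h
        exact ⟨g', S, hSc, a2, a3, fun _ => hS⟩
      · exact ⟨g', ∅, by simp, a2, a3, fun h' => absurd h' h⟩
    choose g' Sτ hSτc hg'av hg'bad hSτ using hτ
    refine ⟨S1 ∪ S1.powerset.biUnion Sτ, ?_, ?_⟩
    · refine (Finset.card_union_le _ _).trans (add_le_add hS1c ?_)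
      refine (Finset.card_biUnion_le_card_mul _ _ k2 fun τ _ => hSτc τ).trans ?_
      rw [Finset.card_powerset]
      exact Nat.mul_le_mul_right _ (Nat.pow_le_pow_right (by norm_num) hS1c)
    intro r hr hrbad
    obtain ⟨w, hw, hLR⟩ := hS1 r (LR_mono le_rfl (fun Q _ hQ => by
        by_cases h : Q = P
        · exact Or.inr h
        · exact Or.inl (Finset.mem_erase.2 ⟨h, hQ⟩)) hr)
      (hrbad.trans (mul_le_mul_of_nonneg_right (min_le_left _ _) hM0.le))
    have hLR' : LR (fun Q => Q ∈ D.erase P) J C1 (r + w) := by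
      refine LR_mono le_rfl (fun Q _ hQ => ?_) hLR
      rcases hQ with hQ | ⟨q1, q2, q3⟩
      · exact hQ
      · exact Finset.mem_erase.2 ⟨q2, hdown P hPD Q q3 q1⟩
    obtain ⟨τ, hτS, hτ1, hτ2⟩ := PIG S1 k1 hS1c σ (fun u => Finset.filter_subset _ _) g h0 hM0
      (fun u => r u ≠ 0) η hη hrbad
    obtain ⟨T, hTS, z, hz, hwz⟩ := Str_explicit hw
    have hb := hg'bad τ (r + w) (LR_ML hLR') (T.filter fun p => p ∈ τ) z (fun p hp => by
      obtain ⟨q1, q2, q3, q4⟩ := hz p (Finset.mem_filter.1 hp).1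
      exact ⟨q1, q2, q4⟩)
    have hsame : ∀ u, (g u * ind (σ u = τ)) * ind (((r + w) + ∑ p ∈ T with p ∈ τ, z p) u ≠ 0)
        = (g u * ind (σ u = τ)) * ind (r u ≠ 0) := by
      intro u
      by_cases hu : σ u = τ
      · have hwu : w u = (∑ p ∈ T with p ∈ τ, z p) u := by
          rw [hwz, Finset.sum_apply, Finset.sum_apply, Finset.sum_filter]
          refine Finset.sum_congr rfl fun p hp => ?_
          rw [← hu]
          simp only [σ, Finset.mem_filter, hTS hp, true_and, Pi.mul_apply]
          rcases zcases (p.2 u) with h | h <;> simp [h]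
        have : ((r + w) + ∑ p ∈ T with p ∈ τ, z p) u = r u := by
          rw [Pi.add_apply, Pi.add_apply, ← hwu, add_assoc, self_add, add_zero]
        rw [this]
      · rw [ind_false hu]; simp
    simp_rw [hsame] at hb
    have hin : r + w ∈ Str J (Sτ τ) := by
      apply hSτ τ _ _ hLR'
      · rw [hg'av]
        calc _ ≤ 2 ^ d * (2 * η * av (fun u => g u * ind (σ u = τ))) := by
              refine hb.trans (mul_le_mul_of_nonneg_left hτ2 (by positivity))
          _ = (η * 2 ^ (d + 1)) * av (fun u => g u * ind (σ u = τ)) := by rw [pow_succ]; ring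
          _ ≤ _ := by
              apply mul_le_mul_of_nonneg_right _ (av_nonneg fun u => mul_nonneg (h0 u) (ind_nonneg _))
              rw [← le_div_iff₀ (by positivity)]
              exact min_le_right _ _
      · rw [hg'av]
        refine le_trans ?_ hτ1
        gcongr
    have h3 : r = (r + w) - w := by abel
    rw [h3]
    refine sub_mem (Str_mono ?_ hin) (Str_mono Finset.subset_union_left hw)
    exact (Finset.subset_biUnion_of_mem Sτ (Finset.mem_powerset.2 hτS)).trans Finset.subset_union_right

lemma one_ML {n : Fin d → ℕ} : (1 : Fn d n) ∈ ML d n ∅ := by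
  refine ⟨fun i hi => absurd hi (by simp), fun i hi u x => by simp⟩

lemma PP_empty : PP d ∅ := by
  refine ⟨1 / 2, by norm_num, fun δ hδ => ⟨0, fun n g h0 h1 hav => ⟨∅, by simp, fun r hr hb => ?_⟩⟩⟩
  have hM0 : 0 < av g := lt_of_lt_of_le hδ hav
  have hconst : ∀ u, r u = r 0 := by
    intro u
    have := ML_pw_eq hr 0 u Finset.univ (by simp)
    simpa using this
  by_cases h : r 0 = 0
  · have : r = 0 := by ext u; rw [hconst, h]; rfl
    rw [this]; exact zero_mem _
  · exfalso
    have : ∀ u, ind (r u ≠ 0) = 1 := fun u => ind_true (by rw [hconst]; exact h)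
    simp_rw [this, mul_one] at hb
    change av g ≤ _ at hb
    linarith

lemma PP_all (J : Finset (Fin d)) : PP d J := by
  classical
  induction J using Finset.strongInduction with
  | H J ih =>
    by_cases hJ : J = ∅
    · subst hJ; exact PP_empty
    obtain ⟨j, hj⟩ := Finset.nonempty_iff_ne_empty.2 hJ
    obtain ⟨η, hη, H⟩ := CLAIM hj ih _ (J.powerset.filter fun Q => j ∈ Q) rfl
      (fun Q hQ => ⟨(Finset.mem_filter.1 hQ).2, Finset.mem_powerset.1 (Finset.mem_filter.1 hQ).1⟩)
      (fun Q hQ Q' hQ' hj' => Finset.mem_filter.2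
        ⟨Finset.mem_powerset.2 (hQ'.trans (Finset.mem_powerset.1 (Finset.mem_filter.1 hQ).1)), hj'⟩)
    refine ⟨η, hη, fun δ hδ => ?_⟩
    obtain ⟨k, H⟩ := H δ hδ 1
    refine ⟨k, fun n g h0 h1 hav => ?_⟩
    obtain ⟨S, hS, H⟩ := H n g h0 h1 hav
    refine ⟨S, hS, fun r hr hb => H r ?_ hb⟩
    rw [← mul_one r]
    refine LR_one (Q := J) ?_ (Finset.Subset.refl _) hr ?_
    · exact Finset.mem_filter.2 ⟨Finset.mem_powerset.2 (Finset.Subset.refl _), hj⟩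
    · rw [sdiff_self]; exact one_ML

end claim
section fourier

def pr {X : Type*} [Fintype X] (r a : X → ZMod 2) : ZMod 2 := ∑ x, r x * a x

variable {X : Type*} [Fintype X] [DecidableEq X]

lemma pr_add (r a b : X → ZMod 2) : pr r (a + b) = pr r a + pr r b := by
  simp [pr, mul_add, Finset.sum_add_distrib]

lemma pr_add' (r s a : X → ZMod 2) : pr (r + s) a = pr r a + pr s a := by
  simp [pr, add_mul, Finset.sum_add_distrib]

lemma av_pr (v : X → ZMod 2) : av (fun r => sg (pr r v)) = ind (v = 0) := by
  rw [av_sg_of_additive (fun r => pr r v) (fun r s => pr_add' r s v)]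
  congr 1
  apply propext
  constructor
  · intro h
    ext x
    have := h (Pi.single x 1)
    simpa [pr, Pi.single_apply] using this
  · rintro rfl r; simp [pr]

noncomputable def fh (A : Finset (X → ZMod 2)) (r : X → ZMod 2) : ℝ := ∑ a ∈ A, sg (pr r a)

lemma av_fh (A : Finset (X → ZMod 2)) (g : X → ZMod 2) :
    av (fun r => fh A r ^ 2 * sg (pr r g)) = ∑ a ∈ A, ind (a + g ∈ A) := by
  have h1 : ∀ r, fh A r ^ 2 * sg (pr r g) = ∑ a ∈ A, ∑ b ∈ A, sg (pr r (a + g + b)) := by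
    intro r
    rw [fh, sq, Finset.sum_mul_sum, Finset.sum_mul]
    refine Finset.sum_congr rfl fun a _ => ?_
    rw [Finset.sum_mul]
    refine Finset.sum_congr rfl fun b _ => ?_
    rw [pr_add, pr_add, sg_add, sg_add]; ring
  simp_rw [h1]
  rw [av_sum]
  refine Finset.sum_congr rfl fun a _ => ?_
  rw [av_sum]
  simp_rw [av_pr]
  have h2 : ∀ b : X → ZMod 2, (a + g + b = 0) ↔ b = a + g := by
    intro b
    constructor
    · intro h
      have : a + g + b + b = b := by rw [h, zero_add]
      rw [add_assoc, self_add, add_zero] at this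
      exact this.symm
    · rintro rfl; exact self_add _
  by_cases hm : a + g ∈ A
  · rw [ind_true hm, Finset.sum_eq_single (a + g)]
    · exact ind_true (self_add _)
    · intro b _ hb; exact ind_false fun h => hb ((h2 b).1 h)
    · intro h; exact absurd hm h
  · rw [ind_false hm]
    apply Finset.sum_eq_zero
    intro b hb
    exact ind_false fun h => hm ((h2 b).1 h ▸ hb)

lemma four {ι : Type*} (A : Finset (X → ZMod 2)) (hA : A.Nonempty) (B : Finset ι) (hB : B.Nonempty)
    (w : ι → X → ZMod 2) (η θ : ℝ) (hη : 0 < η)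
    (hcl : (1 - 2 * η * θ) * A.card * B.card ≤ ∑ u ∈ B, ∑ a ∈ A, ind (a + w u ∈ A))
    (H : Submodule (ZMod 2) (X → ZMod 2))
    (hH : ∀ r, ∑ u ∈ B, ind (pr r (w u) ≠ 0) ≤ η * B.card → ∀ h ∈ H, pr r h = 0) :
    ∃ a ∈ A, (1 - θ) * Nat.card H ≤ ∑ᶠ h : H, ind (a + (h : X → ZMod 2) ∈ A) := by
  classical
  let good : (X → ZMod 2) → Prop := fun r => ∑ u ∈ B, ind (pr r (w u) ≠ 0) ≤ η * B.card
  have hBpos : (0 : ℝ) < B.card := by exact_mod_cast hB.card_pos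
  have hpars : av (fun r => fh A r ^ 2) = A.card := by
    have := av_fh A 0
    have h0 : ∀ r : X → ZMod 2, pr r 0 = 0 := by intro r; simp [pr]
    simp only [h0, sg_zero, mul_one, add_zero] at this
    rw [this, Finset.sum_congr rfl (fun a ha => ind_true ha)]
    simp
  have e1 : ∑ u ∈ B, ∑ a ∈ A, ind (a + w u ∈ A) ≤
      av (fun r => (B.card : ℝ) * ((1 - 2 * η) * fh A r ^ 2 + 2 * η * (fh A r ^ 2 * ind (good r)))) := by
    simp_rw [← av_fh]
    rw [← av_sum]
    apply av_mono
    intro r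
    rw [← Finset.mul_sum]
    have h1 : ∑ u ∈ B, sg (pr r (w u)) = B.card - 2 * ∑ u ∈ B, ind (pr r (w u) ≠ 0) := by
      simp_rw [sg_ind]
      rw [Finset.sum_sub_distrib, ← Finset.mul_sum]; simp
    have h2 : ∑ u ∈ B, sg (pr r (w u)) ≤ B.card * (1 - 2 * η + 2 * η * ind (good r)) := by
      rw [h1]
      by_cases hg : good r
      · rw [ind_true hg]
        have : 0 ≤ ∑ u ∈ B, ind (pr r (w u) ≠ 0) := Finset.sum_nonneg fun u _ => ind_nonneg _
        linarith
      · rw [ind_false hg]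
        simp only [good, not_le] at hg
        linarith
    have := mul_le_mul_of_nonneg_left h2 (sq_nonneg (fh A r))
    linarith
  rw [av_mul, av_add, av_mul, av_mul, hpars] at e1
  set G := av (fun r => fh A r ^ 2 * ind (good r)) with hG
  have e2 : (1 - θ) * A.card ≤ G := by
    have h3 := hcl.trans e1
    have h4 : (B.card : ℝ) * ((1 - 2 * η * θ) * A.card) ≤ B.card * ((1 - 2 * η) * A.card + 2 * η * G) := by linarith
    have h5 := le_of_mul_le_mul_left h4 hBpos
    have h6 : 2 * η * ((1 - θ) * A.card) ≤ 2 * η * G := by linarith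
    exact le_of_mul_le_mul_left h6 (by positivity)
  have e3 : (Fintype.card H : ℝ) * G ≤ ∑ h : H, ∑ a ∈ A, ind (a + (h : X → ZMod 2) ∈ A) := by
    simp_rw [← av_fh]
    rw [← av_sum, ← av_mul]
    apply av_mono
    intro r
    rw [← Finset.mul_sum]
    have hc : (0 : ℝ) < Fintype.card H := by exact_mod_cast Fintype.card_pos
    have h1 : (Fintype.card H : ℝ) * ind (good r) ≤ ∑ h : H, sg (pr r h) := by
      by_cases hg : good r
      · rw [ind_true hg]
        have : ∀ h : H, sg (pr r h) = 1 := fun h => by rw [hH r hg h h.2, sg_zero]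
        simp [this]
      · rw [ind_false hg, mul_zero]
        have h2 := av_sg_of_additive (fun h : H => pr r h) (fun x y => by
          rw [Submodule.coe_add, pr_add])
        have h3 : 0 ≤ av (fun h : H => sg (pr r h)) := by rw [h2]; exact ind_nonneg _
        unfold av at h3
        have := mul_nonneg h3 hc.le
        rwa [div_mul_cancel₀ _ hc.ne'] at this
    have := mul_le_mul_of_nonneg_left h1 (sq_nonneg (fh A r))
    linarith
  rw [Finset.sum_comm] at e3
  have e4 : ∑ a ∈ A, (1 - θ) * (Fintype.card H : ℝ) ≤ ∑ a ∈ A, ∑ h : H, ind (a + (h : X → ZMod 2) ∈ A) := by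
    refine le_trans ?_ e3
    rw [Finset.sum_const, nsmul_eq_mul]
    have := mul_le_mul_of_nonneg_left e2 (Nat.cast_nonneg (α := ℝ) (Fintype.card H))
    linarith
  obtain ⟨a, ha, h⟩ := Finset.exists_le_of_sum_le hA e4
  refine ⟨a, ha, ?_⟩
  rw [finsum_eq_sum_of_fintype, Nat.card_eq_fintype_card]
  exact h

end fourier

section final
variable {d : ℕ} {n : Fin d → ℕ}

lemma prod_ML (x : (i : Fin d) → Fin (n i)) (s : Finset (Fin d)) :
    (fun u => ∏ i ∈ s, u i (x i) : Fn d n) ∈ ML d n s := by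
  classical
  induction s using Finset.induction_on with
  | empty => simp only [Finset.prod_empty]; exact one_ML
  | insert i s hi ih =>
    have := ML_mul (Finset.disjoint_singleton_left.2 hi) (coord_ML i (x i)) ih
    rw [← Finset.insert_eq] at this
    convert this using 1
    ext u
    rw [Finset.prod_insert hi]; rfl

def Fr (d : ℕ) (n : Fin d → ℕ) (r : Arr d n) : Fn d n := fun u => pr r (tensorOf d n u)

lemma Fr_ML (r : Arr d n) : Fr d n r ∈ ML d n Finset.univ := by
  have : Fr d n r = ∑ x, r x • (fun u => ∏ i, u i (x i) : Fn d n) := by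
    ext u; simp [Fr, pr, tensorOf]
  rw [this]
  exact Submodule.sum_mem _ fun x _ => Submodule.smul_mem _ _ (prod_ML x _)

def bt (x : (i : Fin d) → Fin (n i)) : Tup d n := fun i => Pi.single (x i) 1

lemma Fr_bt (r : Arr d n) (x : (i : Fin d) → Fin (n i)) : Fr d n r (bt x) = r x := by
  unfold Fr pr
  rw [Finset.sum_eq_single x]
  · simp [tensorOf, bt]
  · intro y _ hy
    obtain ⟨i, hi⟩ := Function.ne_iff.1 hy
    have : tensorOf d n (bt x) y = 0 := by
      unfold tensorOf
      apply Finset.prod_eq_zero (Finset.mem_univ i)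
      simp [bt, Pi.single_apply, hi]
    rw [this, mul_zero]
  · intro h; exact absurd (Finset.mem_univ _) h

def eI (I : Finset (Fin d)) (y : (i : {x : Fin d // x ∈ I}) → Fin (n i.1)) : Tup d n :=
  fun i => if h : i ∈ I then Pi.single (y ⟨i, h⟩) 1 else 0

def eC (I : Finset (Fin d)) (y : (i : {x : Fin d // x ∉ I}) → Fin (n i.1)) : Tup d n :=
  fun i => if h : i ∈ I then 0 else Pi.single (y ⟨i, h⟩) 1

def HL (I : Finset (Fin d)) (S : Finset (Finset (Fin d) × Fn d n)) : F2I d n I →ₗ[ZMod 2] (S → ZMod 2) where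
  toFun := fun x p => ∑ y, x y * p.1.2 (eI I y)
  map_add' := by intro x x'; ext p; simp [add_mul, Finset.sum_add_distrib]
  map_smul' := by intro c x; ext p; simp [Finset.mul_sum, mul_assoc]

lemma HL_codim (I : Finset (Fin d)) (S : Finset (Finset (Fin d) × Fn d n)) :
    Module.finrank (ZMod 2) (F2I d n I) - Module.finrank (ZMod 2) (LinearMap.ker (HL I S)) ≤ S.card := by
  have h1 := LinearMap.finrank_range_add_finrank_ker (HL I S)
  have h2 := Submodule.finrank_le (LinearMap.range (HL I S))
  rw [Module.finrank_fintype_fun_eq_card, Fintype.card_coe] at h2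
  omega

def joinx (I : Finset (Fin d)) (y : (i : {x : Fin d // x ∈ I}) → Fin (n i.1))
    (z : (i : {x : Fin d // x ∉ I}) → Fin (n i.1)) : (i : Fin d) → Fin (n i) :=
  fun i => if h : i ∈ I then y ⟨i, h⟩ else z ⟨i, h⟩

lemma sum_join (I : Finset (Fin d)) (F : ((i : Fin d) → Fin (n i)) → ZMod 2) :
    ∑ x, F x = ∑ z, ∑ y, F (joinx I y z) := by
  have := Equiv.sum_comp (Equiv.piEquivPiSubtypeProd (fun i => i ∈ I) (fun i => Fin (n i))).symm F
  rw [← this, Fintype.sum_prod_type, Finset.sum_comm]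
  rfl

lemma pair_zero (S : Finset (Finset (Fin d) × Fn d n)) (h : Arr d n)
    (hh : ∀ I : Finset (Fin d), I.Nonempty → h ∈ cylSub d n I (LinearMap.ker (HL I S)))
    (f : Fn d n) (hf : f ∈ Str Finset.univ S) : ∑ x, f (bt x) * h x = 0 := by
  unfold Str at hf
  induction hf using Submodule.span_induction with
  | mem f hf =>
    obtain ⟨p, hp, h1, h2, h3, z, hz, rfl⟩ := hf
    rw [sum_join p.1]
    apply Finset.sum_eq_zero
    intro w _
    have e1 : ∀ y, (p.2 * z) (bt (joinx p.1 y w)) * h (joinx p.1 y w) =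
        z (eC p.1 w) * (arrSlice d n p.1 h w y * p.2 (eI p.1 y)) := by
      intro y
      have a1 : p.2 (bt (joinx p.1 y w)) = p.2 (eI p.1 y) := by
        rw [← ML_pw_eq' h3 0 (bt (joinx p.1 y w)) p.1 (Finset.Subset.refl _)]
        refine congrArg p.2 (funext fun i => ?_)
        by_cases hi : i ∈ p.1 <;> simp [hi, eI, bt, joinx]
      have a2 : z (bt (joinx p.1 y w)) = z (eC p.1 w) := by
        rw [← ML_pw_eq hz (bt (joinx p.1 y w)) 0 p.1 Finset.disjoint_sdiff]
        refine congrArg z (funext fun i => ?_)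
        by_cases hi : i ∈ p.1 <;> simp [hi, eC, bt, joinx]
      rw [Pi.mul_apply, a1, a2]
      change _ * h (joinx p.1 y w) = _ * (h (joinx p.1 y w) * _)
      ring
    simp_rw [e1]
    rw [← Finset.mul_sum]
    have := congrFun (LinearMap.mem_ker.1 (hh p.1 h1 w)) ⟨p, hp⟩
    simp only [HL, LinearMap.coe_mk, AddHom.coe_mk, Pi.zero_apply] at this
    rw [this, mul_zero]
  | zero => simp
  | add x y _ _ hx hy => simp only [Pi.add_apply, add_mul, Finset.sum_add_distrib, hx, hy, add_zero]
  | smul a x _ hx => simp only [Pi.smul_apply, smul_eq_mul, mul_assoc]; rw [← Finset.mul_sum, hx, mul_zero]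

lemma card_Tup : (Fintype.card (Tup d n) : ℝ) = 2 ^ (∑ i, n i) := by
  rw [Fintype.card_pi]
  simp [ZMod.card, Finset.prod_pow_eq_pow_sum]

lemma av_ind_B (B : Finset (Tup d n)) (F : Tup d n → ℝ) :
    av (fun u => ind (u ∈ B) * F u) = (∑ u ∈ B, F u) / 2 ^ (∑ i, n i) := by
  classical
  unfold av
  rw [card_Tup]
  congr 1
  rw [← Finset.sum_subset (Finset.subset_univ B)]
  · exact Finset.sum_congr rfl fun u hu => by rw [ind_true hu, one_mul]
  · intro u _ hu; rw [ind_false hu, zero_mul]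

end final

theorem stmt4 (d : ℕ) (hd : 0 < d) (θ : ℝ) (hθ : 0 < θ) :
    ∃ ε : ℝ, 0 < ε ∧ ∀ δ : ℝ, 0 < δ → ∃ k : ℕ, 0 < k ∧
      ∀ n : Fin d → ℕ, (∀ i, 0 < n i) →
        ∀ B' : Finset (Tup d n), δ * 2 ^ (∑ i, n i) ≤ (B'.card : ℝ) →
          ∀ A : Finset (Arr d n), A.Nonempty →
            ((1 - ε) * A.card * B'.card ≤ (closedCnt d n A B' : ℝ)) →
            ∃ D : Set (Arr d n), IsKSimple d n k D ∧
              (1 - θ) * D.ncard ≤ ((D ∩ ↑A).ncard : ℝ) := by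
  classical
  obtain ⟨η, hη, H⟩ := PP_all (d := d) Finset.univ
  refine ⟨2 * η * θ, by positivity, fun δ hδ => ?_⟩
  obtain ⟨k, H⟩ := H δ hδ
  refine ⟨k + 1, by omega, fun n _ B' hB' A hA hcl => ?_⟩
  have h2pos : (0 : ℝ) < 2 ^ (∑ i, n i) := by positivity
  have hBc : (0 : ℝ) < B'.card := lt_of_lt_of_le (by positivity) hB'
  have hBne : B'.Nonempty := by rw [← Finset.card_pos]; exact_mod_cast hBc
  have havg : av (fun u => ind (u ∈ B')) = (B'.card : ℝ) / 2 ^ (∑ i, n i) := by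
    have := av_ind_B B' (fun _ => 1)
    simpa using this
  obtain ⟨S, hS, hH⟩ := H n (fun u => ind (u ∈ B')) (fun u => ind_nonneg _) (fun u => ind_le_one _)
    (by rw [havg, le_div_iff₀ h2pos]; exact hB')
  let HH : Submodule (ZMod 2) (Arr d n) :=
    ⨅ (I : Finset (Fin d)) (_ : I.Nonempty), cylSub d n I (LinearMap.ker (HL I S))
  have hHH : ∀ h, h ∈ HH ↔ ∀ I : Finset (Fin d), I.Nonempty → h ∈ cylSub d n I (LinearMap.ker (HL I S)) := by
    intro h; simp only [HH, Submodule.mem_iInf]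
  have hcnt : (closedCnt d n A B' : ℝ) = ∑ u ∈ B', ∑ a ∈ A, ind (a + tensorOf d n u ∈ A) := by
    unfold closedCnt
    rw [Finset.card_filter, Finset.sum_product, Finset.sum_comm]
    push_cast
    refine Finset.sum_congr rfl fun u _ => Finset.sum_congr rfl fun a _ => ?_
    by_cases h : a + tensorOf d n u ∈ A
    · rw [ind_true h, if_pos h]
    · rw [ind_false h, if_neg h]
  rw [hcnt] at hcl
  obtain ⟨a, ha, hfin⟩ := four A hA B' hBne (tensorOf d n) η θ hη hcl HH (by
    intro r hr h hh
    have hmem : Fr d n r ∈ Str Finset.univ S := by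
      apply hH _ (Fr_ML r)
      rw [av_ind_B, havg, ← mul_div_assoc]
      exact div_le_div_of_nonneg_right hr h2pos.le
    have := pair_zero S h ((hHH h).1 hh) _ hmem
    simp_rw [Fr_bt] at this
    exact this)
  refine ⟨{x | ∃ r : Arr d n,
      (∀ I : Finset (Fin d), I.Nonempty → r ∈ cylSub d n I (LinearMap.ker (HL I S))) ∧ x = a + r},
    ⟨a, fun I => LinearMap.ker (HL I S), fun I _ => (HL_codim I S).trans (hS.trans (by omega)), rfl⟩, ?_⟩
  have hD : {x | ∃ r : Arr d n,
      (∀ I : Finset (Fin d), I.Nonempty → r ∈ cylSub d n I (LinearMap.ker (HL I S))) ∧ x = a + r}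
      = (fun r => a + r) '' (HH : Set (Arr d n)) := by
    ext x
    simp only [Set.mem_setOf_eq, Set.mem_image, SetLike.mem_coe, hHH]
    constructor
    · rintro ⟨r, h1, h2⟩; exact ⟨r, h1, h2.symm⟩
    · rintro ⟨r, h1, h2⟩; exact ⟨r, h1, h2.symm⟩
  rw [hD]
  have hinj : Function.Injective (fun r : Arr d n => a + r) := add_right_injective a
  have c1 : ((fun r => a + r) '' (HH : Set (Arr d n))).ncard = Nat.card HH := by
    rw [Set.ncard_image_of_injective _ hinj]; rfl
  have c2 : (((fun r => a + r) '' (HH : Set (Arr d n)) ∩ ↑A).ncard : ℝ) =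
      ∑ᶠ h : HH, ind (a + (h : Arr d n) ∈ A) := by
    have e1 : (fun r => a + r) '' (HH : Set (Arr d n)) ∩ ↑A =
        (fun h : HH => a + (h : Arr d n)) '' {h | a + (h : Arr d n) ∈ A} := by
      ext x
      simp only [Set.mem_inter_iff, Set.mem_image, SetLike.mem_coe, Set.mem_setOf_eq]
      constructor
      · rintro ⟨⟨r, h1, rfl⟩, h2⟩; exact ⟨⟨r, h1⟩, h2, rfl⟩
      · rintro ⟨⟨r, h1⟩, h2, rfl⟩; exact ⟨⟨r, h1, rfl⟩, h2⟩
    rw [e1, Set.ncard_image_of_injective _ (fun x y hxy => Subtype.ext (hinj hxy)),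
      finsum_eq_sum_of_fintype, Set.ncard_eq_toFinset_card']
    rw [Set.toFinset_setOf, Finset.card_filter]
    push_cast
    refine Finset.sum_congr rfl fun h _ => ?_
    by_cases h' : a + (h : Arr d n) ∈ A
    · rw [ind_true h', if_pos h']
    · rw [ind_false h', if_neg h']
  rw [c1, c2]
  exact hfin
end
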